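/- arXiv:1201.3381 — 8 statements merged into one kernel-verified Lean document; each statement's English description precedes it below -/
import Mathlib

section
/- (Semi-concavity of the discrete action) For all integers m < n and every x, x' ∈ ℝ^d: the function x' ↦ A_{m,n}(x,x') is 1-semi-concave, and the function x ↦ A_{m,n}(x,x') is (1 + ‖F_m‖_{C²})-semi-concave. -/
open Finset MeasureTheory
open scoped RealInnerProductSpace

noncomputable section

/-- `v ∈ ℤ^d`, i.e. `v` is an integer vector in `ℝ^d`. -/
def IsIntVec {d : ℕ} (v : EuclideanSpace ℝ (Fin d)) : Prop := ∀ i, ∃ k : ℤ, v i = (k : ℝ)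

/-- `f` is `C`-semi-concave: at every point there is a linear form `l` with
`f y - f x ≤ l (y - x) + C/2 ‖y - x‖²`. -/
def SemiConcaveWith {E : Type*} [NormedAddCommGroup E] [NormedSpace ℝ E]
    (C : ℝ) (f : E → ℝ) : Prop :=
  ∀ x : E, ∃ l : E →L[ℝ] ℝ, ∀ y : E, f y - f x ≤ l (y - x) + C / 2 * ‖y - x‖ ^ 2

/-- The `C²` norm `‖f‖_{C²}` of a function on `ℝ^d`. -/
def C2Norm {d : ℕ} (f : EuclideanSpace ℝ (Fin d) → ℝ) : ℝ :=
  ⨆ x : EuclideanSpace ℝ (Fin d),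
    (|f x| + ‖fderiv ℝ f x‖ + ‖fderiv ℝ (fderiv ℝ f) x‖)

/-- The discrete action `A_{m,n}^{b}(x,x')`. -/
def discreteAction (d : ℕ) (b : EuclideanSpace ℝ (Fin d))
    (F : ℤ → EuclideanSpace ℝ (Fin d) → ℝ)
    (m n : ℤ) (x x' : EuclideanSpace ℝ (Fin d)) : ℝ :=
  sInf { a : ℝ | ∃ γ : ℤ → EuclideanSpace ℝ (Fin d),
    IsIntVec (γ m - x) ∧ IsIntVec (γ n - x') ∧
    a = (∑ i ∈ Finset.Ico m n, ((1 : ℝ) / 2 * ‖γ (i + 1) - γ i‖ ^ 2 - F i (γ i)))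
          - ⟪b, γ n - γ m⟫ }

/-- A function on a finite-dimensional space that is bounded below and lies, up to any `ε > 0`,
below a paraboloid of curvature `C` touching it at each point is `C`-semi-concave. -/
theorem SemiConcaveWith.of_approx {E : Type*} [NormedAddCommGroup E] [NormedSpace ℝ E]
    [FiniteDimensional ℝ E] {C B : ℝ} {f : E → ℝ} (hB : ∀ x, B ≤ f x)
    (h : ∀ x, ∀ ε > 0, ∃ l : E →L[ℝ] ℝ,
      ∀ y, f y ≤ f x + ε + l (y - x) + C / 2 * ‖y - x‖ ^ 2) :
    SemiConcaveWith C f := by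
  intro x
  choose l hl using fun k : ℕ => h x (1 / ((k : ℝ) + 1)) Nat.one_div_pos_of_nat
  set M : ℝ := f x + 1 + |C| / 2 - B
  have hM : 0 ≤ M := by
    have := hB x
    have := abs_nonneg C
    simp only [M]
    linarith
  have lower : ∀ k v, ‖v‖ = 1 → -M ≤ l k v := by
    intro k v hv
    have h1 := hl k (x + v)
    have h2 := hB (x + v)
    have h3 : 1 / ((k : ℝ) + 1) ≤ 1 := by
      rw [div_le_one (by positivity)]
      linarith [(Nat.cast_nonneg k : (0 : ℝ) ≤ k)]
    rw [add_sub_cancel_left, hv] at h1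
    have := le_abs_self C
    simp only [M]
    linarith
  have hmem : ∀ k, l k ∈ Metric.closedBall (0 : E →L[ℝ] ℝ) M := by
    intro k
    rw [mem_closedBall_zero_iff]
    refine ContinuousLinearMap.opNorm_le_of_unit_norm hM fun v hv => ?_
    have h1 := lower k v hv
    have h2 := lower k (-v) (by rwa [norm_neg])
    rw [map_neg] at h2
    rw [Real.norm_eq_abs, abs_le]
    constructor <;> linarith
  obtain ⟨L, -, φ, hφ, hL⟩ := (isCompact_closedBall (0 : E →L[ℝ] ℝ) M).tendsto_subseq hmem
  refine ⟨L, fun y => ?_⟩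
  have hLy : Filter.Tendsto (fun k => l (φ k) (y - x)) Filter.atTop (nhds (L (y - x))) :=
    ((ContinuousLinearMap.apply ℝ ℝ (y - x)).continuous.tendsto L).comp hL
  have hε : Filter.Tendsto (fun k => 1 / ((φ k : ℝ) + 1)) Filter.atTop (nhds 0) :=
    tendsto_one_div_add_atTop_nhds_zero_nat.comp hφ.tendsto_atTop
  have key := ge_of_tendsto' (((hε.const_add (f x)).add hLy).add_const (C / 2 * ‖y - x‖ ^ 2))
    fun k => hl (φ k) y
  linarith

/-- A continuous `ℤ^d`-periodic function is bounded. -/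
theorem exists_norm_le_of_periodic {d : ℕ} {G : Type*} [SeminormedAddCommGroup G]
    {g : EuclideanSpace ℝ (Fin d) → G} (hg : Continuous g)
    (hper : ∀ x v, IsIntVec v → g (x + v) = g x) : ∃ K, ∀ x, ‖g x‖ ≤ K := by
  have hK : IsCompact (WithLp.toLp 2 '' (Set.Icc (0 : Fin d → ℝ) 1)) :=
    isCompact_Icc.image (PiLp.continuous_toLp 2 _)
  obtain ⟨K, hK⟩ := hK.exists_bound_of_continuousOn hg.continuousOn
  refine ⟨K, fun x => ?_⟩
  have hx := hper x (WithLp.toLp 2 fun i => -(⌊x i⌋ : ℝ)) fun i => ⟨-⌊x i⌋, by simp⟩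
  rw [← hx]
  refine hK _ ⟨fun i => Int.fract (x i),
    ⟨fun i => Int.fract_nonneg _, fun i => (Int.fract_lt_one _).le⟩, ?_⟩
  ext i
  simp [Int.fract, sub_eq_add_neg]

theorem fderiv_periodic {E G : Type*} [NormedAddCommGroup E] [NormedSpace ℝ E]
    [NormedAddCommGroup G] [NormedSpace ℝ G] {f : E → G} {v : E}
    (h : ∀ x, f (x + v) = f x) (x : E) : fderiv ℝ f (x + v) = fderiv ℝ f x := by
  rw [← fderiv_comp_add_right]
  simp only [h]

theorem norm_fderiv_fderiv_le_C2Norm {d : ℕ} {f : EuclideanSpace ℝ (Fin d) → ℝ}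
    (hf : ContDiff ℝ 2 f) (hper : ∀ x v, IsIntVec v → f (x + v) = f x)
    (x : EuclideanSpace ℝ (Fin d)) : ‖fderiv ℝ (fderiv ℝ f) x‖ ≤ C2Norm f := by
  have hf' : ContDiff ℝ 1 (fderiv ℝ f) := hf.fderiv_right (by norm_num)
  have hper' : ∀ x v, IsIntVec v → fderiv ℝ f (x + v) = fderiv ℝ f x :=
    fun x v hv => fderiv_periodic (fun y => hper y v hv) x
  obtain ⟨K₀, h₀⟩ := exists_norm_le_of_periodic hf.continuous hper
  obtain ⟨K₁, h₁⟩ := exists_norm_le_of_periodic hf'.continuous hper'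
  obtain ⟨K₂, h₂⟩ := exists_norm_le_of_periodic (hf'.continuous_fderiv (by norm_num))
    fun x v hv => fderiv_periodic (fun y => hper' y v hv) x
  have hbdd : BddAbove (Set.range fun x : EuclideanSpace ℝ (Fin d) =>
      |f x| + ‖fderiv ℝ f x‖ + ‖fderiv ℝ (fderiv ℝ f) x‖) := by
    refine ⟨K₀ + K₁ + K₂, ?_⟩
    rintro _ ⟨y, rfl⟩
    exact add_le_add (add_le_add (h₀ y) (h₁ y)) (h₂ y)
  refine le_trans ?_ (le_ciSup hbdd x)
  have := abs_nonneg (f x)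
  have := norm_nonneg (fderiv ℝ f x)
  linarith

/-- Second-order Taylor lower bound from a bound on the second derivative. -/
theorem le_of_norm_fderiv_fderiv_le {E : Type*} [NormedAddCommGroup E] [NormedSpace ℝ E]
    {f : E → ℝ} {K : ℝ} (hf : ContDiff ℝ 2 f) (hK : ∀ x, ‖fderiv ℝ (fderiv ℝ f) x‖ ≤ K)
    (x h : E) : f x + fderiv ℝ f x h - K / 2 * ‖h‖ ^ 2 ≤ f (x + h) := by
  have hf' : ContDiff ℝ 1 (fderiv ℝ f) := hf.fderiv_right (by norm_num)
  have hlip : ∀ y, ‖fderiv ℝ f y - fderiv ℝ f x‖ ≤ K * ‖y - x‖ := fun y =>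
    convex_univ.norm_image_sub_le_of_norm_fderiv_le
      (fun z _ => hf'.differentiable (by norm_num) z) (fun z _ => hK z) trivial trivial
  set φ : ℝ → ℝ := fun t => f (x + t • h) - t * fderiv ℝ f x h + K / 2 * ‖h‖ ^ 2 * t ^ 2
  have hφ : ∀ t, HasDerivAt φ
      (fderiv ℝ f (x + t • h) h - fderiv ℝ f x h + K * ‖h‖ ^ 2 * t) t := by
    intro t
    have hline : HasDerivAt (fun t : ℝ => x + t • h) h t := by
      simpa using ((hasDerivAt_id t).smul_const h).const_add x
    have h1 := ((hf.differentiable (by norm_num) (x + t • h)).hasFDerivAt).comp_hasDerivAt t hline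
    have h2 := (hasDerivAt_id t).mul_const (fderiv ℝ f x h)
    have h3 := ((hasDerivAt_id t).pow 2).const_mul (K / 2 * ‖h‖ ^ 2)
    refine ((h1.sub h2).add h3).congr_deriv ?_
    simp
    ring
  have hmono : MonotoneOn φ (Set.Icc 0 1) := by
    refine monotoneOn_of_deriv_nonneg (convex_Icc 0 1)
      (fun t _ => (hφ t).continuousAt.continuousWithinAt)
      (fun t _ => (hφ t).differentiableAt.differentiableWithinAt) fun t ht => ?_
    rw [interior_Icc] at ht
    rw [(hφ t).deriv]
    have h1 := (fderiv ℝ f (x + t • h) - fderiv ℝ f x).le_of_opNorm_le (hlip (x + t • h)) h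
    rw [add_sub_cancel_left, norm_smul, Real.norm_of_nonneg ht.1.le, Real.norm_eq_abs] at h1
    have h2 := (abs_le.1 h1).1
    rw [sub_apply] at h2
    nlinarith
  have := hmono (Set.left_mem_Icc.2 zero_le_one) (Set.right_mem_Icc.2 zero_le_one) zero_le_one
  simp [φ] at this
  linarith

/-- The action of a path `γ` between the times `m` and `n`. -/
def pathAction {d : ℕ} (b : EuclideanSpace ℝ (Fin d)) (F : ℤ → EuclideanSpace ℝ (Fin d) → ℝ)
    (m n : ℤ) (γ : ℤ → EuclideanSpace ℝ (Fin d)) : ℝ :=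
  (∑ i ∈ Finset.Ico m n, ((1 : ℝ) / 2 * ‖γ (i + 1) - γ i‖ ^ 2 - F i (γ i))) - ⟪b, γ n - γ m⟫

theorem sum_Ico_int_sub {G : Type*} [AddCommGroup G] (γ : ℤ → G) {m n : ℤ} (hmn : m ≤ n) :
    ∑ i ∈ Finset.Ico m n, (γ (i + 1) - γ i) = γ n - γ m := by
  induction n, hmn using Int.leInduction with
  | base => simp
  | succ n hmn ih =>
    rw [← Finset.insert_Ico_right_eq_Ico_add_one hmn, Finset.sum_insert (by simp), ih]
    abel

section pathAction

variable {d : ℕ} {b : EuclideanSpace ℝ (Fin d)} {F : ℤ → EuclideanSpace ℝ (Fin d) → ℝ} {m n : ℤ}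

theorem exists_le_pathAction (hmn : m ≤ n) (hF : ∀ j, Continuous (F j))
    (hFper : ∀ j (x v : EuclideanSpace ℝ (Fin d)), IsIntVec v → F j (x + v) = F j x) :
    ∃ B, ∀ γ, B ≤ pathAction b F m n γ := by
  choose K hK using fun j => exists_norm_le_of_periodic (hF j) (hFper j)
  refine ⟨∑ i ∈ Finset.Ico m n, (-(1 / 2 * ‖b‖ ^ 2) - K i), fun γ => ?_⟩
  rw [pathAction, ← sum_Ico_int_sub γ hmn, inner_sum, ← Finset.sum_sub_distrib]
  refine Finset.sum_le_sum fun i _ => ?_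
  have h1 := (abs_le.1 (hK i (γ i))).2
  have h2 := real_inner_le_norm b (γ (i + 1) - γ i)
  nlinarith [sq_nonneg (‖b‖ - ‖γ (i + 1) - γ i‖)]

theorem discreteAction_le_pathAction {B : ℝ} (hB : ∀ γ, B ≤ pathAction b F m n γ)
    {x x' : EuclideanSpace ℝ (Fin d)} {γ : ℤ → EuclideanSpace ℝ (Fin d)}
    (hm : IsIntVec (γ m - x)) (hn : IsIntVec (γ n - x')) :
    discreteAction d b F m n x x' ≤ pathAction b F m n γ := by
  refine csInf_le ⟨B, ?_⟩ ⟨γ, hm, hn, rfl⟩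
  rintro _ ⟨γ', -, -, rfl⟩
  exact hB γ'

theorem nonempty_setOf_pathAction (hmn : m < n) (x x' : EuclideanSpace ℝ (Fin d)) :
    { a : ℝ | ∃ γ : ℤ → EuclideanSpace ℝ (Fin d), IsIntVec (γ m - x) ∧ IsIntVec (γ n - x') ∧
      a = pathAction b F m n γ }.Nonempty :=
  ⟨_, Function.update (fun _ => x) n x',
    fun i => ⟨0, by simp [Function.update_of_ne hmn.ne]⟩, fun i => ⟨0, by simp⟩, rfl⟩

theorem le_discreteAction (hmn : m < n) {B : ℝ} (hB : ∀ γ, B ≤ pathAction b F m n γ)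
    (x x' : EuclideanSpace ℝ (Fin d)) : B ≤ discreteAction d b F m n x x' := by
  refine le_csInf (nonempty_setOf_pathAction hmn x x') ?_
  rintro _ ⟨γ, -, -, rfl⟩
  exact hB γ

theorem exists_pathAction_lt (hmn : m < n) (x x' : EuclideanSpace ℝ (Fin d)) {ε : ℝ}
    (hε : 0 < ε) : ∃ γ : ℤ → EuclideanSpace ℝ (Fin d), IsIntVec (γ m - x) ∧
      IsIntVec (γ n - x') ∧ pathAction b F m n γ < discreteAction d b F m n x x' + ε := by
  obtain ⟨_, ⟨γ, h1, h2, rfl⟩, h3⟩ :=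
    Real.lt_sInf_add_pos (nonempty_setOf_pathAction (b := b) (F := F) hmn x x') hε
  exact ⟨γ, h1, h2, h3⟩

theorem pathAction_update_right (hmn : m < n) (γ : ℤ → EuclideanSpace ℝ (Fin d))
    (h : EuclideanSpace ℝ (Fin d)) :
    pathAction b F m n (Function.update γ n (γ n + h)) =
      pathAction b F m n γ + ⟪γ n - γ (n - 1) - b, h⟫ + 1 / 2 * ‖h‖ ^ 2 := by
  set γ' := Function.update γ n (γ n + h)
  have hn : γ' n = γ n + h := Function.update_self ..
  have hne : ∀ i, i ≠ n → γ' i = γ i := fun i hi => Function.update_of_ne hi ..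
  have hsum : ∑ i ∈ Finset.Ico m n, ((1 : ℝ) / 2 * ‖γ' (i + 1) - γ' i‖ ^ 2 - F i (γ' i)) -
      ∑ i ∈ Finset.Ico m n, ((1 : ℝ) / 2 * ‖γ (i + 1) - γ i‖ ^ 2 - F i (γ i)) =
      ⟪γ n - γ (n - 1), h⟫ + 1 / 2 * ‖h‖ ^ 2 := by
    rw [← Finset.sum_sub_distrib, Finset.sum_eq_single (n - 1)]
    · rw [sub_add_cancel, hn, hne (n - 1) (by omega),
        show γ n + h - γ (n - 1) = γ n - γ (n - 1) + h by abel, norm_add_sq_real]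
      ring
    · intro i hi hin
      rw [Finset.mem_Ico] at hi
      rw [hne i (by omega), hne (i + 1) (by omega), sub_self]
    · intro hi
      exact absurd (Finset.mem_Ico.2 ⟨by omega, by omega⟩) hi
  have hb : ⟪b, γ' n - γ' m⟫ = ⟪b, γ n - γ m⟫ + ⟪b, h⟫ := by
    rw [hn, hne m hmn.ne, ← inner_add_right]
    congr 1
    abel
  rw [pathAction, pathAction, hb, inner_sub_left _ b]
  linarith

theorem pathAction_update_left (hmn : m < n) (γ : ℤ → EuclideanSpace ℝ (Fin d))
    (h : EuclideanSpace ℝ (Fin d)) :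
    pathAction b F m n (Function.update γ m (γ m + h)) =
      pathAction b F m n γ + ⟪b - (γ (m + 1) - γ m), h⟫ + 1 / 2 * ‖h‖ ^ 2
        - (F m (γ m + h) - F m (γ m)) := by
  set γ' := Function.update γ m (γ m + h)
  have hm : γ' m = γ m + h := Function.update_self ..
  have hne : ∀ i, i ≠ m → γ' i = γ i := fun i hi => Function.update_of_ne hi ..
  have hsum : ∑ i ∈ Finset.Ico m n, ((1 : ℝ) / 2 * ‖γ' (i + 1) - γ' i‖ ^ 2 - F i (γ' i)) -
      ∑ i ∈ Finset.Ico m n, ((1 : ℝ) / 2 * ‖γ (i + 1) - γ i‖ ^ 2 - F i (γ i)) =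
      -⟪γ (m + 1) - γ m, h⟫ + 1 / 2 * ‖h‖ ^ 2 - (F m (γ m + h) - F m (γ m)) := by
    rw [← Finset.sum_sub_distrib, Finset.sum_eq_single m]
    · rw [hm, hne (m + 1) (by omega), ← sub_sub, norm_sub_sq_real]
      ring
    · intro i hi him
      rw [Finset.mem_Ico] at hi
      rw [hne i him, hne (i + 1) (by omega), sub_self]
    · intro hi
      exact absurd (Finset.mem_Ico.2 ⟨le_rfl, hmn⟩) hi
  have hb : ⟪b, γ' n - γ' m⟫ = ⟪b, γ n - γ m⟫ - ⟪b, h⟫ := by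
    rw [hm, hne n hmn.ne', ← sub_sub, inner_sub_right b (γ n - γ m)]
  rw [pathAction, pathAction, hb, inner_sub_left b]
  linarith

end pathAction

/-- **Semi-concavity of the discrete action.** For all integers `m < n` and every
`x, x' ∈ ℝ^d`: the function `x' ↦ A_{m,n}(x,x')` is `1`-semi-concave, and the function
`x ↦ A_{m,n}(x,x')` is `(1 + ‖F_m‖_{C²})`-semi-concave. -/
theorem semiconcavity_of_discrete_action
    (d : ℕ) (hd : 1 ≤ d) (b : EuclideanSpace ℝ (Fin d))
    (F : ℤ → EuclideanSpace ℝ (Fin d) → ℝ)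
    (hF : ∀ j, ContDiff ℝ 2 (F j))
    (hFper : ∀ j (x v : EuclideanSpace ℝ (Fin d)), IsIntVec v → F j (x + v) = F j x)
    (m n : ℤ) (hmn : m < n) :
    (∀ x : EuclideanSpace ℝ (Fin d),
      SemiConcaveWith 1 (fun x' => discreteAction d b F m n x x')) ∧
    (∀ x' : EuclideanSpace ℝ (Fin d),
      SemiConcaveWith (1 + C2Norm (F m)) (fun x => discreteAction d b F m n x x')) := by
  obtain ⟨B, hB⟩ := exists_le_pathAction (b := b) hmn.le (fun j => (hF j).continuous) hFper
  constructor
  · refine fun x => SemiConcaveWith.of_approx (le_discreteAction hmn hB x) fun x' ε hε => ?_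
    obtain ⟨γ, hm, hn, hγ⟩ := exists_pathAction_lt (b := b) (F := F) hmn x x' hε
    refine ⟨innerSL ℝ (γ n - γ (n - 1) - b), fun y => ?_⟩
    have hle := discreteAction_le_pathAction hB (x := x) (x' := y)
      (γ := Function.update γ n (γ n + (y - x')))
      (by rwa [Function.update_of_ne hmn.ne])
      (by rwa [Function.update_self, show γ n + (y - x') - y = γ n - x' by abel])
    rw [pathAction_update_right hmn] at hle
    rw [innerSL_apply_apply]
    linarith
  · refine fun x' => SemiConcaveWith.of_approx (fun x => le_discreteAction hmn hB x x')
      fun x ε hε => ?_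
    obtain ⟨γ, hm, hn, hγ⟩ := exists_pathAction_lt (b := b) (F := F) hmn x x' hε
    refine ⟨innerSL ℝ (b - (γ (m + 1) - γ m)) - fderiv ℝ (F m) (γ m), fun y => ?_⟩
    have hle := discreteAction_le_pathAction hB (x := y) (x' := x')
      (γ := Function.update γ m (γ m + (y - x)))
      (by rwa [Function.update_self, show γ m + (y - x) - y = γ m - x by abel])
      (by rwa [Function.update_of_ne hmn.ne'])
    rw [pathAction_update_left hmn] at hle
    have htaylor := le_of_norm_fderiv_fderiv_le (hF m)
      (norm_fderiv_fderiv_le_C2Norm (hF m) (hFper m)) (γ m) (y - x)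
    rw [sub_apply, innerSL_apply_apply]
    linarith
end
end

section
/- (Generic uniqueness of the minimum) Assume ψ is continuous and that for each c ∈ ℝ^M the map x ↦ ∂_cV(x,c) is one-to-one on the torus, i.e. ∂_cV(x,c) = ∂_cV(y,c) implies x − y ∈ ℤ^d. Then for Lebesgue almost every c ∈ ℝ^M, the function x ↦ H(x,c) attains its global minimum at a unique point of the torus: any two global minimizers x, y of H(·,c) satisfy x − y ∈ ℤ^d. -/
open MeasureTheory
open scoped RealInnerProductSpace

noncomputable section

/-- A compact set containing a representative of every point of the torus `ℝ^d / ℤ^d`. -/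
theorem exists_isCompact_isIntVec_translate_mem (d : ℕ) :
    ∃ K : Set (EuclideanSpace ℝ (Fin d)), IsCompact K ∧ K.Nonempty ∧
      ∀ x, ∃ v, IsIntVec v ∧ x + v ∈ K := by
  refine ⟨WithLp.toLp 2 '' Set.Icc 0 1,
    isCompact_Icc.image (PiLp.continuous_toLp 2 _), ⟨_, 0, ?_, rfl⟩, fun x => ?_⟩
  · exact ⟨le_rfl, zero_le_one⟩
  · refine ⟨WithLp.toLp 2 fun i => -(⌊x i⌋ : ℝ), fun i => ⟨-⌊x i⌋, by simp⟩,
      fun i => Int.fract (x i), ⟨fun i => Int.fract_nonneg _, fun i => (Int.fract_lt_one _).le⟩, ?_⟩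
    ext i
    simp [Int.fract, sub_eq_add_neg]

/-- A minimum over a compact set of a function `H x c` whose dependence on `c` is `C¹`,
with derivative continuous in `(x, c)`, is Lipschitz in `c` on every ball. -/
theorem exists_lipschitzOnWith_ball_of_isMinOn {X E : Type*} [TopologicalSpace X]
    [NormedAddCommGroup E] [NormedSpace ℝ E] [FiniteDimensional ℝ E]
    {K : Set X} (hK : IsCompact K) {H : X → E → ℝ}
    (hd : ∀ x, Differentiable ℝ (H x))
    (hc : Continuous fun p : X × E => fderiv ℝ (H p.1) p.2)
    {m : E → X} (hmK : ∀ c, m c ∈ K) (hm : ∀ c, IsMinOn (fun x => H x c) K (m c)) (r : ℝ) :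
    ∃ C, LipschitzOnWith C (fun c => H (m c) c) (Metric.ball 0 r) := by
  have : ProperSpace E := FiniteDimensional.proper_real E
  obtain ⟨C, hC⟩ := (hK.prod (isCompact_closedBall (0 : E) r)).exists_bound_of_continuousOn
    hc.continuousOn
  refine ⟨C.toNNReal, LipschitzOnWith.of_le_add_mul _ fun a ha b hb => ?_⟩
  have hle : H (m a) a ≤ H (m b) a := hm a (hmK b)
  have hlip : ‖H (m b) a - H (m b) b‖ ≤ C.toNNReal * ‖a - b‖ :=
    (convex_ball (0 : E) r).norm_image_sub_le_of_norm_fderiv_le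
      (fun x _ => hd (m b) x)
      (fun x hx => (hC (m b, x) ⟨hmK b, Metric.ball_subset_closedBall hx⟩).trans
        (Real.le_coe_toNNReal C)) hb ha
  rw [Real.norm_eq_abs, ← dist_eq_norm] at hlip
  linarith [le_abs_self (H (m b) a - H (m b) b)]

/-- A function that is Lipschitz on every ball is differentiable almost everywhere. -/
theorem ae_differentiableAt_of_forall_lipschitzOnWith_ball {E : Type*} [NormedAddCommGroup E]
    [NormedSpace ℝ E] [FiniteDimensional ℝ E] [MeasurableSpace E] [BorelSpace E]
    {μ : Measure E} [μ.IsAddHaarMeasure] {f : E → ℝ}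
    (hf : ∀ r : ℝ, ∃ C, LipschitzOnWith C f (Metric.ball 0 r)) :
    ∀ᵐ c ∂μ, DifferentiableAt ℝ f c := by
  have h : ∀ n : ℕ, ∀ᵐ c ∂μ, c ∈ Metric.ball (0 : E) n →
      DifferentiableWithinAt ℝ f (Metric.ball 0 n) c := fun n => by
    obtain ⟨C, hC⟩ := hf n
    exact hC.ae_differentiableWithinAt_of_mem
  filter_upwards [ae_all_iff.2 h] with c hc
  obtain ⟨n, hn⟩ := exists_nat_gt ‖c‖
  have hcn : c ∈ Metric.ball (0 : E) n := by simpa using hn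
  exact (hc n hcn).differentiableAt (Metric.isOpen_ball.mem_nhds hcn)

/-- If a differentiable function touches another one from above, their derivatives agree. -/
theorem fderiv_eq_of_le_of_eq {E : Type*} [NormedAddCommGroup E] [NormedSpace ℝ E]
    {f g : E → ℝ} {c : E} (hf : DifferentiableAt ℝ f c) (hg : DifferentiableAt ℝ g c)
    (hle : ∀ c', g c' ≤ f c') (heq : f c = g c) : fderiv ℝ f c = fderiv ℝ g c := by
  have hmin : IsLocalMin (f - g) c :=
    Filter.Eventually.of_forall fun c' => by simpa [heq] using hle c'
  have := hmin.fderiv_eq_zero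
  rwa [fderiv_sub hf hg, sub_eq_zero] at this

/-- **Generic uniqueness of the minimum.** If `ψ` is continuous `ℤ^d`-periodic, `V` is `C²`
and `ℤ^d`-periodic in `x`, and for each `c` the map `x ↦ ∂_c V(x,c)` is one-to-one on the
torus, then for Lebesgue a.e. `c`, the function `x ↦ H(x,c) = ψ(x) + V(x,c)` attains its
global minimum at a unique point of the torus. -/
theorem generic_uniqueness_of_minimum
    (d M : ℕ) (hd : 1 ≤ d)
    (ψ : EuclideanSpace ℝ (Fin d) → ℝ) (hψc : Continuous ψ)
    (hψper : ∀ x v, IsIntVec v → ψ (x + v) = ψ x)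
    (V : EuclideanSpace ℝ (Fin d) → EuclideanSpace ℝ (Fin M) → ℝ)
    (hV : ContDiff ℝ 2 fun p : EuclideanSpace ℝ (Fin d) × EuclideanSpace ℝ (Fin M) =>
      V p.1 p.2)
    (hVper : ∀ x v c, IsIntVec v → V (x + v) c = V x c)
    (hinj : ∀ (c : EuclideanSpace ℝ (Fin M)) (x y : EuclideanSpace ℝ (Fin d)),
      gradient (fun c' => V x c') c = gradient (fun c' => V y c') c → IsIntVec (x - y)) :
    ∀ᵐ c ∂(volume : Measure (EuclideanSpace ℝ (Fin M))),
      (∃ x, ∀ y, ψ x + V x c ≤ ψ y + V y c) ∧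
      ∀ x y : EuclideanSpace ℝ (Fin d),
        (∀ z, ψ x + V x c ≤ ψ z + V z c) → (∀ z, ψ y + V y c ≤ ψ z + V z c) →
        IsIntVec (x - y) := by
  obtain ⟨K, hK, hKne, hKt⟩ := exists_isCompact_isIntVec_translate_mem d
  have hdiff : ∀ x, Differentiable ℝ (V x) := fun x =>
    (hV.comp (contDiff_const.prodMk contDiff_id) : ContDiff ℝ 2 (V x)).differentiable two_ne_zero
  have hfderiv : ∀ x c, fderiv ℝ (fun c' => ψ x + V x c') c = fderiv ℝ (V x) c := fun x c =>
    fderiv_const_add _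
  have hcont : Continuous fun p : EuclideanSpace ℝ (Fin d) × EuclideanSpace ℝ (Fin M) =>
      fderiv ℝ (fun c' => ψ p.1 + V p.1 c') p.2 := by
    simp only [hfderiv]
    exact (ContDiff.fderiv (n := 0) (m := 2)
      (f := fun p : EuclideanSpace ℝ (Fin d) × EuclideanSpace ℝ (Fin M) => V p.1)
      (hV.comp ((contDiff_fst.comp contDiff_fst).prodMk contDiff_snd))
      contDiff_snd (by norm_num)).continuous
  have hmin : ∀ c, ∃ x ∈ K, IsMinOn (fun x => ψ x + V x c) K x := fun c =>
    hK.exists_isMinOn hKne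
      (hψc.add (hV.continuous.comp (Continuous.prodMk_left c))).continuousOn
  choose m hmK hm using hmin
  have hglob : ∀ c y, ψ (m c) + V (m c) c ≤ ψ y + V y c := fun c y => by
    obtain ⟨v, hv, hyv⟩ := hKt y
    simpa only [hψper y v hv, hVper y v c hv] using isMinOn_iff.1 (hm c) _ hyv
  have hHdiff : ∀ x, Differentiable ℝ fun c' => ψ x + V x c' := fun x => (hdiff x).const_add _
  filter_upwards [ae_differentiableAt_of_forall_lipschitzOnWith_ball
    (exists_lipschitzOnWith_ball_of_isMinOn hK hHdiff hcont hmK hm)] with c hc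
  have hgrad : ∀ x, (∀ z, ψ x + V x c ≤ ψ z + V z c) →
      fderiv ℝ (V x) c = fderiv ℝ (fun c' => ψ (m c') + V (m c') c') c := fun x hx => by
    rw [← hfderiv]
    exact fderiv_eq_of_le_of_eq (hHdiff x c) hc (fun c' => hglob c' x)
      (le_antisymm (hx _) (hglob c x))
  refine ⟨⟨m c, hglob c⟩, fun x y hx hy => hinj c x y ?_⟩
  exact congrArg (InnerProductSpace.toDual ℝ _).symm ((hgrad x hx).trans (hgrad y hy).symm)
end
end

section
/- (Generic nondegeneracy of the minimum) Assume ψ is semi-concave, that ‖∂²_{cc}V(x,c)‖ ≤ K for all (x,c) and some K ≥ 0, and that for each c ∈ ℝ^M the map x ↦ ∂_cV(x,c) is an embedding of the torus: it is one-to-one modulo ℤ^d and its x-derivative ∂²_{xc}V(x,c) : ℝ^d → ℝ^M is injective for every x. Then for Lebesgue almost every c ∈ ℝ^M the function x ↦ H(x,c) has a unique global minimizer x(c) modulo ℤ^d; moreover H(·,c) is differentiable at x(c) with vanishing derivative, and there exists a positive Borel measurable function a : ℝ^M → (0,∞) such that the second subderivative satisfies d²_xH(x(c),c)(v) ≥ a(c)‖v‖²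 for all v ∈ ℝ^d. -/
open MeasureTheory Filter
open scoped RealInnerProductSpace

noncomputable section

/-- The second subderivative of `f` at `x` (with derivative given by the linear form `df`)
in the direction `w`:
`d²f(x)(w) = liminf_{τ→0⁺} [f(x + τw) − f(x) − τ·df(w)] / (τ²/2)`, with values in `EReal`. -/
def secondSubderiv {E : Type*} [NormedAddCommGroup E] [NormedSpace ℝ E]
    (f : E → ℝ) (x : E) (df : E → ℝ) (w : E) : EReal :=
  Filter.liminf
    (fun τ : ℝ => (((f (x + τ • w) - f x - τ * df w) / (τ ^ 2 / 2) : ℝ) : EReal))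
    (nhdsWithin (0 : ℝ) (Set.Ioi 0))

section

open Topology Set

theorem SemiConcaveWith.concaveOn_sub_sq {E : Type*} [NormedAddCommGroup E]
    [InnerProductSpace ℝ E] {C : ℝ} {f : E → ℝ} (hf : SemiConcaveWith C f) :
    ConcaveOn ℝ univ fun x => f x - C / 2 * ‖x‖ ^ 2 := by
  refine ⟨convex_univ, fun x _ y _ a b ha hb hab => ?_⟩
  obtain ⟨l, hl⟩ := hf (a • x + b • y)
  set z := a • x + b • y with hz
  have key : ∀ u, f u - C / 2 * ‖u‖ ^ 2
      ≤ f z - C / 2 * ‖z‖ ^ 2 + (l (u - z) - C * ⟪z, u - z⟫) := by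
    intro u
    have h1 := hl u
    have h2 : ‖u‖ ^ 2 = ‖z‖ ^ 2 + 2 * ⟪z, u - z⟫ + ‖u - z‖ ^ 2 := by
      rw [← norm_add_sq_real]; simp
    rw [h2]; linarith
  have h0 : a * (l (x - z) - C * ⟪z, x - z⟫) + b * (l (y - z) - C * ⟪z, y - z⟫) = 0 := by
    have hv : a • (x - z) + b • (y - z) = 0 := by
      have : a • (x - z) + b • (y - z) = z - (a + b) • z := by rw [hz]; module
      rw [this, hab, one_smul, sub_self]
    have e1 : a * l (x - z) + b * l (y - z) = 0 := by
      rw [← smul_eq_mul, ← smul_eq_mul, ← map_smul, ← map_smul, ← map_add, hv, map_zero]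
    have e2 : a * ⟪z, x - z⟫ + b * ⟪z, y - z⟫ = 0 := by
      rw [← inner_smul_right, ← inner_smul_right, ← inner_add_right, hv, inner_zero_right]
    linear_combination e1 - C * e2
  have hx := mul_le_mul_of_nonneg_left (key x) ha
  have hy := mul_le_mul_of_nonneg_left (key y) hb
  simp only [smul_eq_mul]
  have : (a + b) * (f z - C / 2 * ‖z‖ ^ 2) = f z - C / 2 * ‖z‖ ^ 2 := by rw [hab, one_mul]
  linarith

theorem SemiConcaveWith.continuous {E : Type*} [NormedAddCommGroup E]
    [InnerProductSpace ℝ E] [FiniteDimensional ℝ E] {C : ℝ} {f : E → ℝ}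
    (hf : SemiConcaveWith C f) : Continuous f := by
  have h := hf.concaveOn_sub_sq.locallyLipschitz.continuous.add
    (by fun_prop : Continuous fun x : E => C / 2 * ‖x‖ ^ 2)
  refine h.congr fun x => ?_
  simp

theorem LocallyLipschitz.ae_differentiableAt {E F : Type*} [NormedAddCommGroup E]
    [NormedSpace ℝ E] [FiniteDimensional ℝ E] [MeasurableSpace E] [BorelSpace E]
    [NormedAddCommGroup F] [NormedSpace ℝ F] [FiniteDimensional ℝ F] {μ : Measure E}
    [μ.IsAddHaarMeasure] {f : E → F} (hf : LocallyLipschitz f) :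
    ∀ᵐ x ∂μ, DifferentiableAt ℝ f x := by
  have h : ∀ n : ℕ, ∀ᵐ x ∂μ, x ∈ Metric.closedBall (0 : E) n →
      DifferentiableWithinAt ℝ f (Metric.closedBall (0 : E) n) x := fun n => by
    obtain ⟨K, hK⟩ := LocallyLipschitzOn.exists_lipschitzOnWith_of_compact
      (isCompact_closedBall (0 : E) n) hf.locallyLipschitzOn
    exact hK.ae_differentiableWithinAt_of_mem
  filter_upwards [ae_all_iff.2 h] with x hx
  obtain ⟨n, hn⟩ := exists_nat_gt ‖x‖
  refine (hx n (by simpa using hn.le)).differentiableAt ?_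
  exact Metric.closedBall_mem_nhds_of_mem (by simpa using hn)

theorem SemiConcaveWith.ae_differentiableAt {E : Type*} [NormedAddCommGroup E]
    [InnerProductSpace ℝ E] [FiniteDimensional ℝ E] [MeasurableSpace E] [BorelSpace E]
    {μ : Measure E} [μ.IsAddHaarMeasure] {C : ℝ} {f : E → ℝ} (hf : SemiConcaveWith C f) :
    ∀ᵐ x ∂μ, DifferentiableAt ℝ f x := by
  filter_upwards [hf.concaveOn_sub_sq.locallyLipschitz.ae_differentiableAt (μ := μ)] with x hx
  have h := hx.add (((differentiable_id.norm_sq ℝ).const_mul (C / 2)) x)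
  refine h.congr_of_eventuallyEq (Eventually.of_forall fun y => ?_)
  simp

theorem LipschitzWith.addHaar_image_eq_zero {E : Type*} [NormedAddCommGroup E]
    [InnerProductSpace ℝ E] [FiniteDimensional ℝ E] [MeasurableSpace E] [BorelSpace E]
    {μ : Measure E} [μ.IsAddHaarMeasure] {K : NNReal} {f : E → E} (hf : LipschitzWith K f)
    {s : Set E} (hs : μ s = 0) : μ (f '' s) = 0 := by
  set ν : Measure E := Measure.hausdorffMeasure (Module.finrank ℝ E)
  have h1 : ν s = 0 := Measure.absolutelyContinuous_isAddHaarMeasure ν μ hs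
  have h2 : ν (f '' s) = 0 := by
    refine le_antisymm ((hf.hausdorffMeasure_image_le (Nat.cast_nonneg _) s).trans ?_) zero_le
    change _ * ν s ≤ 0
    rw [h1, mul_zero]
  exact Measure.absolutelyContinuous_isAddHaarMeasure μ ν h2

/-- Outside a null set, a Lipschitz self-map has invertible derivative at every point of the
fibre. -/
theorem LipschitzWith.ae_forall_fiber_antilipschitz {E : Type*} [NormedAddCommGroup E]
    [InnerProductSpace ℝ E] [FiniteDimensional ℝ E] [MeasurableSpace E] [BorelSpace E]
    {μ : Measure E} [μ.IsAddHaarMeasure] {K : NNReal} {g : E → E} (hg : LipschitzWith K g) :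
    ∀ᵐ c ∂μ, ∀ y, g y = c → ∃ L : ℝ, 0 < L ∧ ∀ᶠ z in 𝓝 y, ‖z - y‖ ≤ L * ‖g z - c‖ := by
  set N₁ := {y | ¬ DifferentiableAt ℝ g y}
  set N₂ := {y | DifferentiableAt ℝ g y ∧ (fderiv ℝ g y).det = 0}
  have h1 : μ (g '' N₁) = 0 := hg.addHaar_image_eq_zero (hg.ae_differentiableAt (μ := μ))
  have h2 : μ (g '' N₂) = 0 :=
    addHaar_image_eq_zero_of_det_fderivWithin_eq_zero μ
      (fun y hy => hy.1.hasFDerivAt.hasFDerivWithinAt) (fun y hy => hy.2)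
  filter_upwards [measure_eq_zero_iff_ae_notMem.1 h1, measure_eq_zero_iff_ae_notMem.1 h2]
    with c hc1 hc2 y hy
  have hd : DifferentiableAt ℝ g y := by
    by_contra h; exact hc1 ⟨y, h, hy⟩
  have hdet : (fderiv ℝ g y).det ≠ 0 := fun h => hc2 ⟨y, ⟨hd, h⟩, hy⟩
  have hker : LinearMap.ker (fderiv ℝ g y : E →ₗ[ℝ] E) = ⊥ := by
    refine LinearMap.ker_eq_bot.2 fun a b hab => ?_
    exact ((fderiv ℝ g y).toContinuousLinearEquivOfDetNeZero hdet).injective (by simpa using hab)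
  obtain ⟨k, hk, hanti⟩ := LinearMap.exists_antilipschitzWith _ hker
  have hk' : (0 : ℝ) < k := hk
  refine ⟨2 * k, by positivity, ?_⟩
  have ho := (hd.hasFDerivAt.isLittleO).def (c := 1 / (2 * k)) (by positivity)
  filter_upwards [ho] with z hz
  have h3 : ‖z - y‖ ≤ k * ‖fderiv ℝ g y (z - y)‖ := by
    rw [map_sub]
    simpa only [dist_eq_norm, ContinuousLinearMap.coe_coe] using hanti.le_mul_dist z y
  have h4 : ‖fderiv ℝ g y (z - y)‖ ≤ ‖g z - c‖ + 1 / (2 * k) * ‖z - y‖ := by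
    rw [← hy]
    calc _ = ‖(g z - g y) - (g z - g y - fderiv ℝ g y (z - y))‖ := by congr 1; abel
      _ ≤ _ := (_root_.norm_sub_le _ _).trans (by gcongr)
  have h5 : ‖z - y‖ ≤ k * (‖g z - c‖ + 1 / (2 * k) * ‖z - y‖) :=
    h3.trans (by gcongr)
  have h6 : k * (1 / (2 * k) * ‖z - y‖) = ‖z - y‖ / 2 := by field_simp
  rw [mul_add, h6] at h5
  linarith

/-- If `p` selects supergradients of the semi-concave function `G`, then at almost every point
where `p` is continuous, `G` also lies above a paraboloid. -/
theorem ae_exists_lower_paraboloid {E : Type*} [NormedAddCommGroup E]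
    [InnerProductSpace ℝ E] [FiniteDimensional ℝ E] [MeasurableSpace E] [BorelSpace E]
    {μ : Measure E} [μ.IsAddHaarMeasure] {G : E → ℝ} {p : E → E} {K : ℝ} (hK : 0 ≤ K)
    (hp : ∀ c c', G c' ≤ G c + ⟪p c, c' - c⟫ + K * ‖c' - c‖ ^ 2) :
    ∀ᵐ c ∂μ, ContinuousAt p c → ∃ A : ℝ, 0 ≤ A ∧
      ∀ᶠ c' in 𝓝 c, G c + ⟪p c, c' - c⟫ - A * ‖c' - c‖ ^ 2 ≤ G c' := by
  set Y : E → E := fun c => (2 * K + 1) • c - p c with hY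
  have hmono : ∀ c c', ‖c' - c‖ ≤ ‖Y c' - Y c‖ := by
    intro c c'
    have h1 := hp c c'
    have h2 := hp c' c
    have h3 : ⟪p c', c - c'⟫ = - ⟪p c', c' - c⟫ := by rw [← inner_neg_right, neg_sub]
    rw [h3, norm_sub_rev c c'] at h2
    have h4 : ⟪Y c' - Y c, c' - c⟫ =
        (2 * K + 1) * ‖c' - c‖ ^ 2 - (⟪p c', c' - c⟫ - ⟪p c, c' - c⟫) := by
      have : Y c' - Y c = (2 * K + 1) • (c' - c) - (p c' - p c) := by simp only [hY]; module
      rw [this, inner_sub_left, inner_smul_left, real_inner_self_eq_norm_sq, inner_sub_left]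
      simp
    have h5 := real_inner_le_norm (Y c' - Y c) (c' - c)
    rcases (norm_nonneg (c' - c)).eq_or_lt with h | h
    · rw [← h]; positivity
    · refine le_of_mul_le_mul_right ?_ h
      nlinarith
  have hinj : Function.Injective Y := fun c c' h => by
    have := hmono c c'
    rw [h, sub_self, norm_zero] at this
    exact (sub_eq_zero.1 (norm_le_zero_iff.1 this)).symm
  have hlip : LipschitzOnWith 1 (Function.invFun Y) (range Y) := by
    refine LipschitzOnWith.of_dist_le_mul ?_
    rintro _ ⟨a, rfl⟩ _ ⟨b, rfl⟩
    simpa [Function.leftInverse_invFun hinj a, Function.leftInverse_invFun hinj b, dist_eq_norm]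
      using hmono b a
  obtain ⟨g, hg, hgeq⟩ := hlip.extend_finite_dimension
  have hgY : ∀ c, g (Y c) = c := fun c => by
    rw [← hgeq (mem_range_self c)]; exact Function.leftInverse_invFun hinj c
  filter_upwards [hg.ae_forall_fiber_antilipschitz (μ := μ)] with c hc hcont
  obtain ⟨L, hL, hev⟩ := hc (Y c) (hgY c)
  refine ⟨L + K, by positivity, ?_⟩
  have hYc : ContinuousAt Y c := (continuousAt_id.const_smul _).sub hcont
  filter_upwards [hYc.eventually hev] with c' hc'
  rw [hgY] at hc'
  have h2 := hp c' c
  have h3 : ⟪p c', c - c'⟫ = - ⟪p c', c' - c⟫ := by rw [← inner_neg_right, neg_sub]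
  rw [h3, norm_sub_rev c c'] at h2
  have h4 : ⟪Y c' - Y c, c' - c⟫ =
      (2 * K + 1) * ‖c' - c‖ ^ 2 - (⟪p c', c' - c⟫ - ⟪p c, c' - c⟫) := by
    have : Y c' - Y c = (2 * K + 1) • (c' - c) - (p c' - p c) := by simp only [hY]; module
    rw [this, inner_sub_left, inner_smul_left, real_inner_self_eq_norm_sq, inner_sub_left]
    simp
  have h5 := real_inner_le_norm (Y c' - Y c) (c' - c)
  have h6 := mul_le_mul_of_nonneg_right hc' (norm_nonneg (c' - c))
  have h7 : 0 ≤ K * ‖c' - c‖ ^ 2 := by positivity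
  nlinarith

theorem exists_quadratic_growth {E F : Type*} [NormedAddCommGroup E] [NormedSpace ℝ E]
    [FiniteDimensional ℝ E] [NormedAddCommGroup F] [InnerProductSpace ℝ F]
    {P : E → F} {B : E →L[ℝ] F} {x : E} (hP : HasFDerivAt P B x) (hB : Function.Injective B)
    {h : E → ℝ} {A : ℝ} (hA : 0 ≤ A)
    (hh : ∀ᶠ w in 𝓝 (0 : F), ∀ z, h x + ⟪P x, w⟫ - ⟪P z, w⟫ - A * ‖w‖ ^ 2 ≤ h z) :
    ∃ ε > 0, ∀ᶠ u in 𝓝 (0 : E), h x + ε * ‖u‖ ^ 2 ≤ h (x + u) := by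
  obtain ⟨k, hk, hanti⟩ := LinearMap.exists_antilipschitzWith (B : E →ₗ[ℝ] F)
    (LinearMap.ker_eq_bot.2 hB)
  have hk' : (0 : ℝ) < k := hk
  set t : ℝ := 1 / (2 * (A + 1)) with ht
  have ht0 : 0 < t := by positivity
  have htA : A * t ≤ 1 / 2 := by
    rw [ht, mul_one_div, div_le_div_iff₀ (by positivity) (by positivity)]; linarith
  refine ⟨t / (4 * k ^ 2), by positivity, ?_⟩
  have hw : Tendsto (fun u : E => -(t • B u)) (𝓝 0) (𝓝 0) := by
    have : Continuous fun u : E => -(t • B u) := by fun_prop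
    simpa using this.tendsto 0
  have ho := (hasFDerivAt_iff_isLittleO_nhds_zero.1 hP).def (c := 1 / (4 * k)) (by positivity)
  filter_upwards [hw.eventually hh, ho] with u hu he
  have h1 := hu (x + u)
  set e := P (x + u) - P x - B u with hedef
  have hPz : P (x + u) = P x + (B u + e) := by rw [hedef]; abel
  have hin : ⟪P x, -(t • B u)⟫ - ⟪P (x + u), -(t • B u)⟫ = t * ‖B u‖ ^ 2 + t * ⟪e, B u⟫ := by
    rw [hPz, inner_add_left, inner_add_left]
    simp only [inner_neg_right, inner_smul_right, real_inner_self_eq_norm_sq]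
    ring
  have hnw : ‖-(t • B u)‖ ^ 2 = t ^ 2 * ‖B u‖ ^ 2 := by
    rw [norm_neg, norm_smul, mul_pow, Real.norm_of_nonneg ht0.le]
  have hBu : ‖u‖ ≤ k * ‖B u‖ := by simpa using hanti.le_mul_norm_sub u 0
  have hee : ‖e‖ ≤ ‖B u‖ / 4 := by
    refine he.trans ?_
    calc 1 / (4 * k) * ‖u‖ ≤ 1 / (4 * k) * (k * ‖B u‖) := by gcongr
      _ = ‖B u‖ / 4 := by field_simp
  have hcs : -(‖B u‖ ^ 2 / 4) ≤ ⟪e, B u⟫ := by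
    have := abs_le.1 (abs_real_inner_le_norm e (B u))
    nlinarith [norm_nonneg (B u)]
  have hfin : t / (4 * k ^ 2) * ‖u‖ ^ 2 ≤ t * ‖B u‖ ^ 2 / 4 := by
    calc _ ≤ t / (4 * k ^ 2) * (k * ‖B u‖) ^ 2 := by gcongr
      _ = _ := by field_simp
  rw [hnw] at h1
  have h7 : A * (t ^ 2 * ‖B u‖ ^ 2) ≤ 1 / 2 * (t * ‖B u‖ ^ 2) := by
    calc _ = A * t * (t * ‖B u‖ ^ 2) := by ring
      _ ≤ _ := by gcongr
  have h8 := mul_le_mul_of_nonneg_left hcs ht0.le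
  linarith

theorem abs_sub_sub_inner_gradient_le {F : Type*} [NormedAddCommGroup F]
    [InnerProductSpace ℝ F] [CompleteSpace F] {f : F → ℝ} (hf : ContDiff ℝ 2 f) {K : ℝ}
    (hK : ∀ c, ‖iteratedFDeriv ℝ 2 f c‖ ≤ K) (c c' : F) :
    |f c' - f c - ⟪gradient f c, c' - c⟫| ≤ K * ‖c' - c‖ ^ 2 := by
  have hK0 : 0 ≤ K := (norm_nonneg _).trans (hK c)
  have hf1 : Differentiable ℝ f := hf.differentiable (by norm_num)
  have hf2 : Differentiable ℝ (fderiv ℝ f) :=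
    (hf.fderiv_right (m := 1) (by norm_num)).differentiable (by norm_num)
  have hb : ∀ z, ‖fderiv ℝ (fderiv ℝ f) z‖ ≤ K := fun z => by
    rw [← norm_iteratedFDeriv_one, norm_iteratedFDeriv_fderiv]; exact hK z
  have hl : ∀ z, ‖fderiv ℝ f z - fderiv ℝ f c‖ ≤ K * ‖z - c‖ := fun z =>
    convex_univ.norm_image_sub_le_of_norm_fderiv_le (fun y _ => hf2 y) (fun y _ => hb y)
      (mem_univ _) (mem_univ _)
  have h := (convex_segment c c').norm_image_sub_le_of_norm_fderiv_le' (f := f)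
    (φ := fderiv ℝ f c) (C := K * ‖c' - c‖) (fun y _ => hf1 y)
    (fun y hy => (hl y).trans (by gcongr; exact norm_sub_le_of_mem_segment hy))
    (left_mem_segment ℝ c c') (right_mem_segment ℝ c c')
  have hg : ⟪gradient f c, c' - c⟫ = fderiv ℝ f c (c' - c) := by
    simp [gradient]
  rw [hg, ← Real.norm_eq_abs]
  refine h.trans (le_of_eq (by ring))

theorem contDiff_gradient_right {E F : Type*} [NormedAddCommGroup E] [NormedSpace ℝ E]
    [NormedAddCommGroup F] [InnerProductSpace ℝ F] [CompleteSpace F] {V : E → F → ℝ}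
    (hV : ContDiff ℝ 2 fun q : E × F => V q.1 q.2) :
    ContDiff ℝ 1 fun q : E × F => gradient (V q.1) q.2 := by
  have h1 : ContDiff ℝ 1 fun q : E × F => fderiv ℝ (V q.1) q.2 := by
    refine ContDiff.fderiv (m := 2) (f := fun q : E × F => V q.1) ?_ contDiff_snd (by norm_num)
    exact hV.comp ((contDiff_fst.comp contDiff_fst).prodMk contDiff_snd)
  have h2 : IsBoundedLinearMap ℝ fun φ : StrongDual ℝ F => (InnerProductSpace.toDual ℝ F).symm φ :=
    ⟨⟨fun a b => by simp, fun a b => by simp⟩, 1, one_pos, fun a => by simp⟩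
  exact h2.contDiff.comp h1

/-- A semi-concave function plus a differentiable one is differentiable at a global minimum. -/
theorem SemiConcaveWith.hasFDerivAt_zero_of_forall_le {E : Type*} [NormedAddCommGroup E]
    [NormedSpace ℝ E] {C : ℝ} {f g : E → ℝ} (hf : SemiConcaveWith C f) {x : E}
    (hg : DifferentiableAt ℝ g x) (hmin : ∀ y, f x + g x ≤ f y + g y) :
    HasFDerivAt (fun y => f y + g y) (0 : E →L[ℝ] ℝ) x := by
  obtain ⟨l, hl⟩ := hf x
  set U : E → ℝ := fun y => l (y - x) + C / 2 * ‖y - x‖ ^ 2 + (g y - g x) with hU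
  have hsq : HasFDerivAt (fun y : E => C / 2 * ‖y - x‖ ^ 2) (0 : E →L[ℝ] ℝ) x := by
    rw [hasFDerivAt_iff_isLittleO_nhds_zero]
    simp only [add_sub_cancel_left, sub_self, norm_zero, zero_apply, sub_zero]
    have h := (Asymptotics.isLittleO_norm_pow_id (E' := E) (n := 2) one_lt_two).const_mul_left
      (C / 2)
    simpa using h
  have hUd : HasFDerivAt U (l + 0 + fderiv ℝ g x) x := by
    refine (HasFDerivAt.add ?_ hsq).add (hg.hasFDerivAt.sub_const (g x))
    exact l.hasFDerivAt.comp x ((hasFDerivAt_id x).sub_const x)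
  have hU0 : U x = 0 := by simp [hU]
  have hle : ∀ y, f y + g y - (f x + g x) ≤ U y := fun y => by
    have := hl y
    simp only [hU]; linarith
  have hz : l + 0 + fderiv ℝ g x = 0 := by
    refine IsLocalMin.hasFDerivAt_eq_zero (Eventually.of_forall fun y => ?_) hUd
    rw [hU0]
    exact (sub_nonneg.2 (hmin y)).trans (hle y)
  rw [hz, hasFDerivAt_iff_isLittleO] at hUd
  rw [hasFDerivAt_iff_isLittleO]
  refine (Asymptotics.isBigO_of_le _ fun y => ?_).trans_isLittleO hUd
  have h0 := sub_nonneg.2 (hmin y)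
  simp only [zero_apply, sub_zero, hU0, Real.norm_eq_abs]
  rw [abs_of_nonneg h0]
  exact (hle y).trans (le_abs_self _)

theorem isCompact_unitCube (d : ℕ) :
    IsCompact {x : EuclideanSpace ℝ (Fin d) | ∀ i, x i ∈ Icc (0 : ℝ) 1} := by
  have h : IsCompact (univ.pi fun _ : Fin d => Icc (0 : ℝ) 1) :=
    isCompact_univ_pi fun _ => isCompact_Icc
  have h2 := (EuclideanSpace.equiv (Fin d) ℝ).toHomeomorph.isCompact_preimage.2 h
  convert h2 using 1
  ext x
  exact ⟨fun hx i _ => hx i, fun hx i => hx i (mem_univ i)⟩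

theorem exists_isIntVec_add_mem_unitCube {d : ℕ} (x : EuclideanSpace ℝ (Fin d)) :
    ∃ v : EuclideanSpace ℝ (Fin d), IsIntVec v ∧ ∀ i, (x + v) i ∈ Icc (0 : ℝ) 1 := by
  refine ⟨WithLp.toLp 2 fun i => -((⌊x i⌋ : ℤ) : ℝ), fun i => ⟨-⌊x i⌋, by simp⟩, fun i => ?_⟩
  have h1 := Int.floor_le (x i)
  have h2 := (Int.lt_floor_add_one (x i)).le
  simp only [PiLp.add_apply, mem_Icc]
  constructor <;> linarith

theorem exists_forall_le_of_periodic {d : ℕ} {f : EuclideanSpace ℝ (Fin d) → ℝ}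
    (hf : Continuous f) (hper : ∀ x v, IsIntVec v → f (x + v) = f x) :
    ∃ x, (∀ i, x i ∈ Icc (0 : ℝ) 1) ∧ ∀ y, f x ≤ f y := by
  obtain ⟨x, hx, hmin⟩ := (isCompact_unitCube d).exists_isMinOn
    ⟨0, fun i => by simp⟩ hf.continuousOn
  refine ⟨x, hx, fun y => ?_⟩
  obtain ⟨v, hv, hyv⟩ := exists_isIntVec_add_mem_unitCube y
  rw [← hper y v hv]
  exact hmin hyv

theorem isClosed_setOf_exists_quadratic_growth {E F : Type*} [NormedAddCommGroup E]
    [TopologicalSpace F] {Q : Set E} (hQ : IsCompact Q) {H : E → F → ℝ}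
    (hH : Continuous fun q : E × F => H q.1 q.2) (r : ℝ) :
    IsClosed {c | ∃ x ∈ Q, (∀ y, H x c ≤ H y c) ∧
      ∀ u, ‖u‖ ≤ r → H x c + r * ‖u‖ ^ 2 ≤ H (x + u) c} := by
  have : CompactSpace Q := isCompact_iff_compactSpace.1 hQ
  set S : Set (Q × F) := {q | (∀ y, H q.1 q.2 ≤ H y q.2) ∧
    ∀ u, ‖u‖ ≤ r → H q.1 q.2 + r * ‖u‖ ^ 2 ≤ H (q.1 + u) q.2} with hS
  have hc : ∀ g : Q × F → E, Continuous g → Continuous fun q : Q × F => H (g q) q.2 :=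
    fun g hg => hH.comp (hg.prodMk continuous_snd)
  have hcoe : Continuous fun q : Q × F => (q.1 : E) := by fun_prop
  have hSc : IsClosed S := by
    simp only [hS, ofPred_and, ofPred_forall]
    refine (isClosed_iInter fun y => isClosed_le (hc _ hcoe) (hc _ continuous_const)).inter
      (isClosed_iInter fun u => isClosed_iInter fun _ => isClosed_le
        ((hc _ hcoe).add continuous_const) (hc _ (hcoe.add continuous_const)))
  convert isClosedMap_snd_of_compactSpace S hSc using 1
  ext c
  constructor
  · rintro ⟨x, hx, h⟩
    exact ⟨(⟨x, hx⟩, c), h, rfl⟩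
  · rintro ⟨⟨x, c'⟩, h, rfl⟩
    exact ⟨x, x.2, h⟩

theorem continuousAt_comp_minimizer {E F X : Type*} [TopologicalSpace E] [TopologicalSpace F]
    [TopologicalSpace X] {Q : Set E} (hQ : IsCompact Q) {H : E → F → ℝ}
    (hH : Continuous fun q : E × F => H q.1 q.2) {P : E → F → X}
    (hP : Continuous fun q : E × F => P q.1 q.2) {m : F → E} (hmQ : ∀ c, m c ∈ Q)
    (hm : ∀ c y, H (m c) c ≤ H y c) {c : F}
    (huniq : ∀ x, (∀ y, H x c ≤ H y c) → P x c = P (m c) c) :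
    ContinuousAt (fun c => P (m c) c) c := by
  refine (Filter.tendsto_iff_ultrafilter _ _ _).2 fun U hU => ?_
  obtain ⟨x, -, hx⟩ := hQ.ultrafilter_le_nhds (U.map m)
    (le_principal_iff.2 (Filter.mem_map.2 (Filter.univ_mem' hmQ)))
  have hmx : Tendsto m U (𝓝 x) := hx
  have hlim : Tendsto (fun c' => (m c', c')) U (𝓝 (x, c)) := hmx.prodMk_nhds hU
  change Tendsto _ _ (𝓝 (P (m c) c))
  rw [← huniq x fun y => ?_]
  · exact (hP.tendsto (x, c)).comp hlim
  · exact le_of_tendsto_of_tendsto' ((hH.tendsto (x, c)).comp hlim)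
      ((hH.tendsto (y, c)).comp (tendsto_const_nhds.prodMk_nhds hU)) fun c' => hm c' y

theorem le_secondSubderiv_of_quadratic_growth {E : Type*} [NormedAddCommGroup E]
    [NormedSpace ℝ E] {f : E → ℝ} {x : E} {r : ℝ} (hr : 0 < r)
    (h : ∀ u, ‖u‖ ≤ r → f x + r * ‖u‖ ^ 2 ≤ f (x + u)) (v : E) :
    ((r * ‖v‖ ^ 2 : ℝ) : EReal) ≤ secondSubderiv f x (fun _ => 0) v := by
  refine le_liminf_of_le (by isBoundedDefault) ?_
  have hsmall : ∀ᶠ τ in 𝓝 (0 : ℝ), ‖τ • v‖ ≤ r := by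
    have hc : Tendsto (fun τ : ℝ => ‖τ • v‖) (𝓝 0) (𝓝 0) := by
      have : Continuous fun τ : ℝ => ‖τ • v‖ := by fun_prop
      simpa using this.tendsto 0
    exact hc.eventually (eventually_le_nhds hr)
  filter_upwards [nhdsWithin_le_nhds hsmall, self_mem_nhdsWithin] with τ hτ hτ0
  have hτ0' : (0 : ℝ) < τ := hτ0
  have h1 := h (τ • v) hτ
  rw [norm_smul, mul_pow, Real.norm_of_nonneg hτ0'.le] at h1
  rw [EReal.coe_le_coe_iff, le_div_iff₀ (by positivity)]
  have h2 : 0 ≤ r * ‖v‖ ^ 2 * τ ^ 2 := by positivity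
  linarith

/-- A sequence of measurable sets yields a positive measurable function which on their union
takes the value `1 / (n + 1)`, with `n` the index of a set containing the point. -/
theorem exists_measurable_pos_of_iUnion {X : Type*} [MeasurableSpace X] {D : ℕ → Set X}
    (hD : ∀ n, MeasurableSet (D n)) :
    ∃ a : X → ℝ, Measurable a ∧ (∀ c, 0 < a c) ∧
      ∀ c ∈ ⋃ n, D n, ∃ n : ℕ, c ∈ D n ∧ a c = 1 / ((n : ℝ) + 1) := by
  classical
  set p : X → ℕ → Prop := fun c n => c ∈ D n ∪ (⋃ n, D n)ᶜ with hp
  have hex : ∀ c, ∃ n, p c n := fun c => by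
    by_cases h : c ∈ ⋃ n, D n
    · obtain ⟨n, hn⟩ := mem_iUnion.1 h
      exact ⟨n, Or.inl hn⟩
    · exact ⟨0, Or.inr h⟩
  have hm : Measurable fun c => Nat.find (hex c) :=
    measurable_find hex fun k => (hD k).union (MeasurableSet.iUnion hD).compl
  refine ⟨fun c => 1 / ((Nat.find (hex c) : ℝ) + 1), ?_, fun c => by positivity, fun c hc => ?_⟩
  · exact (measurable_from_nat (f := fun n : ℕ => 1 / ((n : ℝ) + 1))).comp hm
  · refine ⟨Nat.find (hex c), ?_, rfl⟩
    exact (Nat.find_spec (hex c)).resolve_right fun h => h hc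

end

/-- **Generic nondegeneracy of the minimum.** If `ψ` is semi-concave and `ℤ^d`-periodic,
`V` is `C²`, `ℤ^d`-periodic in `x`, with `‖∂²_{cc}V‖ ≤ K`, and for every `c` the map
`x ↦ ∂_c V(x,c)` is an embedding of the torus, then for Lebesgue a.e. `c` the function
`H(·,c) = ψ + V(·,c)` has a unique global minimizer `x(c)` mod `ℤ^d`, `H(·,c)` is
differentiable at `x(c)` with vanishing derivative, and for some positive Borel function
`a` the second subderivative satisfies `d²_x H(x(c),c)(v) ≥ a(c)‖v‖²`. -/
theorem generic_nondegeneracy_of_minimum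
    (d M : ℕ) (hd : 1 ≤ d)
    (ψ : EuclideanSpace ℝ (Fin d) → ℝ)
    (hψper : ∀ x v, IsIntVec v → ψ (x + v) = ψ x)
    (hψsc : ∃ C > 0, SemiConcaveWith C ψ)
    (V : EuclideanSpace ℝ (Fin d) → EuclideanSpace ℝ (Fin M) → ℝ)
    (hV : ContDiff ℝ 2 fun p : EuclideanSpace ℝ (Fin d) × EuclideanSpace ℝ (Fin M) =>
      V p.1 p.2)
    (hVper : ∀ x v c, IsIntVec v → V (x + v) c = V x c)
    (K : ℝ) (hK0 : 0 ≤ K)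
    (hK : ∀ x c, ‖iteratedFDeriv ℝ 2 (fun c' => V x c') c‖ ≤ K)
    (hinj : ∀ (c : EuclideanSpace ℝ (Fin M)) (x y : EuclideanSpace ℝ (Fin d)),
      gradient (fun c' => V x c') c = gradient (fun c' => V y c') c → IsIntVec (x - y))
    (himm : ∀ (c : EuclideanSpace ℝ (Fin M)) (x : EuclideanSpace ℝ (Fin d)),
      Function.Injective
        fun u => fderiv ℝ (fun x' => gradient (fun c' => V x' c') c) x u) :
    ∃ a : EuclideanSpace ℝ (Fin M) → ℝ, Measurable a ∧ (∀ c, 0 < a c) ∧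
      ∀ᵐ c ∂(volume : Measure (EuclideanSpace ℝ (Fin M))),
        ∃ x : EuclideanSpace ℝ (Fin d),
          (∀ y, ψ x + V x c ≤ ψ y + V y c) ∧
          (∀ y, (∀ z, ψ y + V y c ≤ ψ z + V z c) → IsIntVec (y - x)) ∧
          HasFDerivAt (fun x' => ψ x' + V x' c)
            (0 : EuclideanSpace ℝ (Fin d) →L[ℝ] ℝ) x ∧
          ∀ v : EuclideanSpace ℝ (Fin d),
            ((a c * ‖v‖ ^ 2 : ℝ) : EReal) ≤
              secondSubderiv (fun x' => ψ x' + V x' c) x (fun _ => 0) v := by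
  obtain ⟨C, -, hsc⟩ := hψsc
  have hVc : ∀ x, ContDiff ℝ 2 fun c => V x c := fun x =>
    hV.comp (contDiff_const.prodMk contDiff_id)
  have hVx : ∀ c, ContDiff ℝ 2 fun x => V x c := fun c =>
    hV.comp (contDiff_id.prodMk contDiff_const)
  have hH : Continuous fun q : EuclideanSpace ℝ (Fin d) × EuclideanSpace ℝ (Fin M) =>
      ψ q.1 + V q.1 q.2 := (hsc.continuous.comp continuous_fst).add hV.continuous
  have hP := contDiff_gradient_right hV
  have hmin : ∀ c, ∃ x, (∀ i, x i ∈ Set.Icc (0 : ℝ) 1) ∧ ∀ y, ψ x + V x c ≤ ψ y + V y c :=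
    fun c => exists_forall_le_of_periodic
      (hsc.continuous.add (hVx c).continuous) fun x v hv => by rw [hψper x v hv, hVper x v c hv]
  choose m hmQ hm using hmin
  set G : EuclideanSpace ℝ (Fin M) → ℝ := fun c => ψ (m c) + V (m c) c with hG
  have hTaylor : ∀ x c c', V x c' ≤ V x c + ⟪gradient (V x) c, c' - c⟫ + K * ‖c' - c‖ ^ 2 :=
    fun x c c' => by
      have := (abs_le.1 (abs_sub_sub_inner_gradient_le (hVc x) (hK x) c c')).2
      linarith
  have hp : ∀ c c', G c' ≤ G c + ⟪gradient (V (m c)) c, c' - c⟫ + K * ‖c' - c‖ ^ 2 :=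
    fun c c' => by
      have h1 := hm c' (m c)
      have h2 := hTaylor (m c) c c'
      simp only [hG]; linarith
  have hGsc : SemiConcaveWith (2 * K) G := fun c =>
    ⟨innerSL ℝ (gradient (V (m c)) c), fun c' => by
      have := hp c c'
      rw [innerSL_apply_apply]; linarith⟩
  set D : ℕ → Set (EuclideanSpace ℝ (Fin M)) := fun n =>
    {c | ∃ x ∈ {x : EuclideanSpace ℝ (Fin d) | ∀ i, x i ∈ Set.Icc (0 : ℝ) 1},
      (∀ y, ψ x + V x c ≤ ψ y + V y c) ∧ ∀ u, ‖u‖ ≤ 1 / ((n : ℝ) + 1) →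
        ψ x + V x c + 1 / ((n : ℝ) + 1) * ‖u‖ ^ 2 ≤ ψ (x + u) + V (x + u) c} with hD
  obtain ⟨a, ha, hapos, haD⟩ := exists_measurable_pos_of_iUnion (D := D) fun n =>
    (isClosed_setOf_exists_quadratic_growth (isCompact_unitCube d) hH _).measurableSet
  refine ⟨a, ha, hapos, ?_⟩
  filter_upwards [hGsc.ae_differentiableAt, ae_exists_lower_paraboloid hK0 hp]
    with c hdiff hpar
  have hgrad : ∀ x, (∀ y, ψ x + V x c ≤ ψ y + V y c) → gradient (V x) c = gradient G c := by
    intro x hx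
    have hd : HasFDerivAt (fun c' => ψ x + V x c' - G c')
        (fderiv ℝ (V x) c - fderiv ℝ G c) c :=
      ((((hVc x).differentiable (by norm_num) c).hasFDerivAt).const_add (ψ x)).sub
        hdiff.hasFDerivAt
    have h0 := IsLocalMin.hasFDerivAt_eq_zero (Eventually.of_forall fun c' => ?_) hd
    · rw [gradient, gradient, sub_eq_zero.1 h0]
    · have h1 := hm c' x
      have h2 := hx (m c)
      simp only [hG]; linarith
  have hcont := continuousAt_comp_minimizer (isCompact_unitCube d)
    (H := fun x c => ψ x + V x c) (P := fun x c => gradient (V x) c) hH hP.continuous hmQ hm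
    fun x hx => (hgrad x hx).trans (hgrad (m c) (hm c)).symm
  obtain ⟨A, hA, hlow⟩ := hpar hcont
  have hPd : HasFDerivAt (fun x => gradient (V x) c)
      (fderiv ℝ (fun x => gradient (V x) c) (m c)) (m c) :=
    (((hP.comp (contDiff_id.prodMk contDiff_const)).differentiable one_ne_zero) _).hasFDerivAt
  have htrans : Tendsto (fun w => c + w) (nhds 0) (nhds c) := by
    have : Continuous fun w => c + w := by fun_prop
    simpa using this.tendsto 0
  obtain ⟨ε, hε, hgrow⟩ := exists_quadratic_growth (h := fun x => ψ x + V x c) (A := A + K)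
    hPd (himm c (m c)) (by positivity) (by
      filter_upwards [htrans.eventually hlow] with w hw z
      have h1 := hm (c + w) z
      have h2 := hTaylor z c (c + w)
      rw [add_sub_cancel_left] at hw h2
      simp only [hG] at hw
      linarith)
  obtain ⟨δ, hδ, hball⟩ := Metric.eventually_nhds_iff.1 hgrow
  obtain ⟨n, hn⟩ := exists_nat_one_div_lt (lt_min hε hδ)
  have hcD : c ∈ ⋃ n, D n := by
    refine Set.mem_iUnion.2 ⟨n, m c, hmQ c, hm c, fun u hu => ?_⟩
    have h1 := hball (y := u) (by
      rw [dist_zero_right]; exact hu.trans_lt (hn.trans_le (min_le_right _ _)))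
    have h2 : 1 / ((n : ℝ) + 1) * ‖u‖ ^ 2 ≤ ε * ‖u‖ ^ 2 := by
      gcongr; exact (hn.trans_le (min_le_left _ _)).le
    linarith
  obtain ⟨k, ⟨x, -, hx, hxg⟩, hak⟩ := haD c hcD
  refine ⟨x, hx, fun y hy => hinj c y x ((hgrad y hy).trans (hgrad x hx).symm),
    hsc.hasFDerivAt_zero_of_forall_le ((hVx c).differentiable (by norm_num) x) hx, ?_⟩
  rw [hak]
  exact le_secondSubderiv_of_quadratic_growth (by positivity) hxg
end
end

section
/- (Differentiability of a semi-concave function at a minimum) Let φ : ℝ^k → ℝ be C-semi-concave for some C > 0, and suppose φ attains a global minimum at x₀. Then φ is differentiable at x₀ and Dφ(x₀) = 0; equivalently, the zero linear form is the unique subderivative of φ at x₀. -/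
open scoped RealInnerProductSpace

noncomputable section

/-- A linear form whose negative part is controlled by a multiple of the squared norm
vanishes. -/
theorem eq_zero_of_nonneg_add_mul_norm_sq {E : Type*} [NormedAddCommGroup E] [NormedSpace ℝ E]
    {l : E →L[ℝ] ℝ} {c : ℝ} (h : ∀ v, 0 ≤ l v + c * ‖v‖ ^ 2) : l = 0 := by
  ext v
  have hd : discrim (c * ‖v‖ ^ 2) (l v) 0 ≤ 0 := by
    refine discrim_le_zero fun t => ?_
    have ht := h (t • v)
    rw [map_smul, smul_eq_mul, norm_smul, mul_pow, Real.norm_eq_abs, sq_abs] at ht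
    linarith
  rw [discrim, mul_zero, sub_zero] at hd
  simpa using le_antisymm hd (sq_nonneg (l v))

/-- At a global minimum, the only linear form bounding a function from above up to a quadratic
error is zero. -/
theorem subderivative_eq_zero_of_forall_le {E : Type*} [NormedAddCommGroup E] [NormedSpace ℝ E]
    {f : E → ℝ} {c : ℝ} {x₀ : E} (hmin : ∀ y, f x₀ ≤ f y) {l : E →L[ℝ] ℝ}
    (hl : ∀ y, f y - f x₀ ≤ l (y - x₀) + c * ‖y - x₀‖ ^ 2) : l = 0 := by
  refine eq_zero_of_nonneg_add_mul_norm_sq (c := c) fun v => ?_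
  have hv := hl (x₀ + v)
  rw [add_sub_cancel_left] at hv
  linarith [hmin (x₀ + v)]

/-- A semi-concave function has derivative zero at a global minimum. -/
theorem SemiConcaveWith.hasFDerivAt_zero {E : Type*} [NormedAddCommGroup E] [NormedSpace ℝ E]
    {f : E → ℝ} {C : ℝ} (hf : SemiConcaveWith C f) {x₀ : E} (hmin : ∀ y, f x₀ ≤ f y) :
    HasFDerivAt f (0 : E →L[ℝ] ℝ) x₀ := by
  obtain ⟨l, hl⟩ := hf x₀
  obtain rfl := subderivative_eq_zero_of_forall_le hmin hl
  have hO : (fun y => f y - f x₀) =O[nhds x₀] fun y => ‖y - x₀‖ ^ 2 := by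
    refine Asymptotics.IsBigO.of_bound (C / 2) (Filter.Eventually.of_forall fun y => ?_)
    rw [Real.norm_of_nonneg (sub_nonneg.2 (hmin y)), Real.norm_of_nonneg (by positivity)]
    simpa using hl y
  exact (hasFDerivAt_sub_const_iff (f x₀)).1 (hO.hasFDerivAt one_lt_two)

/-- **Differentiability of a semi-concave function at a minimum.** If `φ : ℝ^k → ℝ` is
`C`-semi-concave and attains a global minimum at `x₀`, then `φ` is differentiable at `x₀`
with `Dφ(x₀) = 0`; equivalently, the zero linear form is the unique subderivative of `φ`
at `x₀`. -/
theorem semiConcave_differentiable_at_min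
    (k : ℕ) (C : ℝ) (hC : 0 < C)
    (φ : EuclideanSpace ℝ (Fin k) → ℝ)
    (hφ : SemiConcaveWith C φ)
    (x₀ : EuclideanSpace ℝ (Fin k)) (hmin : ∀ y, φ x₀ ≤ φ y) :
    HasFDerivAt φ (0 : EuclideanSpace ℝ (Fin k) →L[ℝ] ℝ) x₀ ∧
    ∀ l : EuclideanSpace ℝ (Fin k) →L[ℝ] ℝ,
      (∀ y, φ y - φ x₀ ≤ l (y - x₀) + C / 2 * ‖y - x₀‖ ^ 2) → l = 0 := by
  exact ⟨hφ.hasFDerivAt_zero hmin, fun _ hl => subderivative_eq_zero_of_forall_le hmin hl⟩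
end
end

section
/- (Duality of second subderivatives) Assume ψ is semi-concave and ‖∂²_{cc}V(x,c)‖ ≤ K for all (x,c) and some K ≥ 0. Call (x,c) ∈ ℝ^d × ℝ^M a conjugate pair if G(c) = H(x,c), the function H(·,c) is differentiable at x with ∂_xH(x,c) = 0, and G is differentiable at c with DG(c) = ∂_cV(x,c). Then for every conjugate pair (x,c) and all v ∈ ℝ^d, w ∈ ℝ^M: ½ d²_xH(x,c)(v) ≥ ½ d²G(c)(w) − ⟨∂²_{cx}V(x,c)v, w⟩ − K‖w‖², where ∂²_{cx}V(x,c) : ℝ^d → ℝ^M is the mixed second partial derivative of V at (x,c). -/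
open MeasureTheory Filter
open scoped RealInnerProductSpace

noncomputable section

/-- The value function `G(c) = inf_x (ψ(x) + V(x,c))`. -/
def valueFun {d M : ℕ} (ψ : EuclideanSpace ℝ (Fin d) → ℝ)
    (V : EuclideanSpace ℝ (Fin d) → EuclideanSpace ℝ (Fin M) → ℝ)
    (c : EuclideanSpace ℝ (Fin M)) : ℝ :=
  sInf (Set.range fun x => ψ x + V x c)

/-- Mean value estimate: if the second derivative of `φ` is bounded by `K`, then the first-order
Taylor remainder of `φ` is at most `K * ‖h‖ ^ 2`. -/
lemma sub_sub_fderiv_le_of_norm_iteratedFDeriv_two_le {E : Type*} [NormedAddCommGroup E]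
    [NormedSpace ℝ E] {φ : E → ℝ} (hφ : ContDiff ℝ 2 φ) {K : ℝ}
    (hK : ∀ c, ‖iteratedFDeriv ℝ 2 φ c‖ ≤ K) (c h : E) :
    φ (c + h) - φ c - fderiv ℝ φ c h ≤ K * ‖h‖ ^ 2 := by
  have hK0 : 0 ≤ K := (norm_nonneg _).trans (hK c)
  have hd : Differentiable ℝ (fderiv ℝ φ) :=
    (hφ.fderiv_right (m := 1) (by norm_num)).differentiable (by norm_num)
  have hlip (z : E) : ‖fderiv ℝ φ z - fderiv ℝ φ c‖ ≤ K * ‖z - c‖ := by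
    refine Convex.norm_image_sub_le_of_norm_fderiv_le (𝕜 := ℝ) (fun y _ => hd y) (fun y _ => ?_)
      convex_univ (Set.mem_univ c) (Set.mem_univ z)
    rw [← norm_iteratedFDeriv_one, norm_iteratedFDeriv_fderiv]
    exact hK y
  have key := Convex.norm_image_sub_le_of_norm_fderiv_le' (𝕜 := ℝ) (f := φ)
    (φ := fderiv ℝ φ c) (C := K * ‖h‖) (s := Metric.closedBall c ‖h‖) (x := c) (y := c + h)
    (fun y _ => hφ.differentiable (by norm_num) y)
    (fun y hy => (hlip y).trans (by
      rw [mem_closedBall_iff_norm] at hy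
      gcongr))
    (convex_closedBall _ _) (by simp) (by simp)
  rw [add_sub_cancel_left] at key
  calc _ ≤ _ := Real.le_norm_self _
    _ ≤ _ := key
    _ = _ := by ring

lemma isIntVec_single {d : ℕ} (i : Fin d) (k : ℤ) :
    IsIntVec (EuclideanSpace.single i (k : ℝ)) := fun j =>
  ⟨if j = i then k else 0, by simp⟩

/-- Every vector differs from an integer vector by a vector with coordinates in `[-1, 1]`. -/
lemma exists_isIntVec_abs_sub_le_one {d : ℕ} (x : EuclideanSpace ℝ (Fin d)) :
    ∃ n : EuclideanSpace ℝ (Fin d), IsIntVec n ∧ ∀ i, |(n - x) i| ≤ 1 := by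
  refine ⟨WithLp.toLp 2 fun i => (round (x i) : ℝ), fun i => ⟨round (x i), rfl⟩, fun i => ?_⟩
  have := abs_sub_round (x i)
  rw [abs_sub_comm] at this
  simpa using this.trans (by norm_num : (1 / 2 : ℝ) ≤ 1)

lemma euclideanSpace_eq_sum_smul_single {d : ℕ} (u : EuclideanSpace ℝ (Fin d)) :
    u = ∑ i, u i • EuclideanSpace.single i (1 : ℝ) := by
  ext j
  simp [Pi.single_apply]

lemma norm_le_natCast_of_abs_le_one {d : ℕ} {u : EuclideanSpace ℝ (Fin d)} (hu : ∀ i, |u i| ≤ 1) :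
    ‖u‖ ≤ d := by
  rw [euclideanSpace_eq_sum_smul_single u]
  refine (norm_sum_le_of_le Finset.univ (n := fun _ => (1 : ℝ)) fun i _ => ?_).trans (by simp)
  simpa [norm_smul] using hu i

/-- A periodic semi-concave function is bounded below. -/
lemma SemiConcaveWith.exists_le_of_periodic {d : ℕ} {C : ℝ} (hC : 0 < C)
    {ψ : EuclideanSpace ℝ (Fin d) → ℝ} (hψ : SemiConcaveWith C ψ)
    (hper : ∀ x v, IsIntVec v → ψ (x + v) = ψ x) : ∃ m, ∀ x, m ≤ ψ x := by
  refine ⟨ψ 0 - (d * (C / 2) + C / 2 * (d : ℝ) ^ 2), fun x => ?_⟩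
  obtain ⟨l, hl⟩ := hψ x
  have hl_single (i : Fin d) : |l (EuclideanSpace.single i 1)| ≤ C / 2 := by
    have h1 := hl (x + EuclideanSpace.single i 1)
    have h2 := hl (x + EuclideanSpace.single i (-1))
    rw [hper _ _ (by simpa using isIntVec_single i 1)] at h1
    rw [hper _ _ (by simpa using isIntVec_single i (-1))] at h2
    have h3 : EuclideanSpace.single i (-1 : ℝ) = -EuclideanSpace.single i (1 : ℝ) := by
      ext j
      by_cases h : j = i <;> simp [h]
    rw [h3] at h2
    simp only [add_sub_cancel_left, sub_self, map_neg, norm_neg, PiLp.norm_single,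
      norm_one, one_pow, mul_one] at h1 h2
    exact abs_le.2 ⟨by linarith, by linarith⟩
  obtain ⟨n, hn, hnx⟩ := exists_isIntVec_abs_sub_le_one x
  have hψn : ψ n = ψ 0 := by simpa using hper 0 n hn
  have hln : l (n - x) ≤ d * (C / 2) := by
    rw [euclideanSpace_eq_sum_smul_single (n - x), map_sum]
    calc _ ≤ ∑ _i : Fin d, C / 2 := Finset.sum_le_sum fun i _ => by
          rw [map_smul, smul_eq_mul]
          refine (le_abs_self _).trans ?_
          rw [abs_mul]
          nlinarith [hnx i, hl_single i, abs_nonneg ((n - x) i),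
            abs_nonneg (l (EuclideanSpace.single i 1))]
      _ = d * (C / 2) := by simp
  have hsq : C / 2 * ‖n - x‖ ^ 2 ≤ C / 2 * (d : ℝ) ^ 2 := by
    have := norm_le_natCast_of_abs_le_one hnx
    gcongr
  linarith [hl n]

/-- A continuous periodic function is bounded below. -/
lemma Continuous.exists_le_of_isIntVec_periodic {d : ℕ} {f : EuclideanSpace ℝ (Fin d) → ℝ}
    (hf : Continuous f) (hper : ∀ x v, IsIntVec v → f (x + v) = f x) : ∃ m, ∀ x, m ≤ f x := by
  obtain ⟨m, hm⟩ := (isCompact_closedBall (0 : EuclideanSpace ℝ (Fin d)) d).bddBelow_image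
    hf.continuousOn
  refine ⟨m, fun x => ?_⟩
  obtain ⟨n, hn, hnx⟩ := exists_isIntVec_abs_sub_le_one x
  have hmem : x - n ∈ Metric.closedBall (0 : EuclideanSpace ℝ (Fin d)) d := by
    rw [mem_closedBall_zero_iff, norm_sub_rev]
    exact norm_le_natCast_of_abs_le_one hnx
  have := hm (Set.mem_image_of_mem f hmem)
  rwa [← hper _ n hn, sub_add_cancel] at this

/-- **Duality of second subderivatives.** If `ψ` is semi-concave, `‖∂²_{cc}V‖ ≤ K`, and
`(x,c)` is a conjugate pair (`G(c) = H(x,c)`, `∂_x H(x,c) = 0`, `DG(c) = ∂_c V(x,c)`),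
then for all `v ∈ ℝ^d`, `w ∈ ℝ^M`:
`½ d²_x H(x,c)(v) ≥ ½ d²G(c)(w) − ⟨∂²_{cx}V(x,c)v, w⟩ − K‖w‖²`. -/
theorem duality_of_second_subderivatives
    (d M : ℕ) (hd : 1 ≤ d)
    (ψ : EuclideanSpace ℝ (Fin d) → ℝ)
    (hψper : ∀ x v, IsIntVec v → ψ (x + v) = ψ x)
    (hψsc : ∃ C > 0, SemiConcaveWith C ψ)
    (V : EuclideanSpace ℝ (Fin d) → EuclideanSpace ℝ (Fin M) → ℝ)
    (hV : ContDiff ℝ 2 fun p : EuclideanSpace ℝ (Fin d) × EuclideanSpace ℝ (Fin M) =>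
      V p.1 p.2)
    (hVper : ∀ x v c, IsIntVec v → V (x + v) c = V x c)
    (K : ℝ) (hK0 : 0 ≤ K)
    (hK : ∀ x c, ‖iteratedFDeriv ℝ 2 (fun c' => V x c') c‖ ≤ K)
    (x : EuclideanSpace ℝ (Fin d)) (c : EuclideanSpace ℝ (Fin M))
    (hval : valueFun ψ V c = ψ x + V x c)
    (hHx : HasFDerivAt (fun x' => ψ x' + V x' c)
      (0 : EuclideanSpace ℝ (Fin d) →L[ℝ] ℝ) x)
    (hGc : HasGradientAt (valueFun ψ V) (gradient (fun c' => V x c') c) c)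
    (v : EuclideanSpace ℝ (Fin d)) (w : EuclideanSpace ℝ (Fin M)) :
    ((1 / 2 : ℝ) : EReal) *
        secondSubderiv (valueFun ψ V) c
          (fun w' => ⟪gradient (fun c' => V x c') c, w'⟫) w -
      (((⟪fderiv ℝ (fun x' => gradient (fun c' => V x' c') c) x v, w⟫ +
          K * ‖w‖ ^ 2 : ℝ)) : EReal) ≤
    ((1 / 2 : ℝ) : EReal) *
        secondSubderiv (fun x' => ψ x' + V x' c) x (fun _ => 0) v := by
  obtain ⟨C, hC, hsc⟩ := hψsc
  have hVc (y : EuclideanSpace ℝ (Fin d)) : ContDiff ℝ 2 (V y) :=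
    hV.comp (contDiff_prodMk_right y)
  have hbdd (c' : EuclideanSpace ℝ (Fin M)) : BddBelow (Set.range fun y => ψ y + V y c') := by
    obtain ⟨m₁, hm₁⟩ := hsc.exists_le_of_periodic hC hψper
    obtain ⟨m₂, hm₂⟩ := Continuous.exists_le_of_isIntVec_periodic (f := fun y => V y c')
      (hV.continuous.comp (by fun_prop : Continuous fun y => (y, c'))) fun y n => hVper y n c'
    refine ⟨m₁ + m₂, ?_⟩
    rintro _ ⟨y, rfl⟩
    exact add_le_add (hm₁ y) (hm₂ y)
  set g : EuclideanSpace ℝ (Fin d) → EuclideanSpace ℝ (Fin M) :=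
    fun x' => gradient (fun c' => V x' c') c
  have hg_inner (y) : ⟪g y, w⟫ = fderiv ℝ (V y) c w := InnerProductSpace.toDual_symm_apply
  have hg_diff : DifferentiableAt ℝ g x := by
    have h1 : ContDiff ℝ 1 fun y => fderiv ℝ (V y) c :=
      ContDiff.fderiv (m := 2) hV contDiff_const (by norm_num)
    exact (InnerProductSpace.toDual ℝ (EuclideanSpace ℝ (Fin M))).symm.toContinuousLinearEquiv
      |>.differentiableAt.comp x (h1.differentiable (by norm_num) x)
  set b : ℝ := ⟪fderiv ℝ g x v, w⟫ + K * ‖w‖ ^ 2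
  let r : ℝ → ℝ := fun τ => 2 * (⟪τ⁻¹ • (g (x + τ • v) - g x), w⟫ + K * ‖w‖ ^ 2)
  have hr : Tendsto r (nhdsWithin 0 (Set.Ioi 0)) (nhds (2 * b)) := by
    have h1 := (hg_diff.hasFDerivAt.hasLineDerivAt v).tendsto_slope_zero_right
    exact ((h1.inner tendsto_const_nhds).add_const _).const_mul 2
  have hquot (τ : ℝ) (hτ : 0 < τ) :
      (valueFun ψ V (c + τ • w) - valueFun ψ V c - τ * ⟪g x, w⟫) / (τ ^ 2 / 2) ≤
        r τ + (ψ (x + τ • v) + V (x + τ • v) c - (ψ x + V x c) - τ * 0) / (τ ^ 2 / 2) := by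
    have h1 : valueFun ψ V (c + τ • w) ≤ ψ (x + τ • v) + V (x + τ • v) (c + τ • w) :=
      csInf_le (hbdd _) ⟨_, rfl⟩
    have h2 := sub_sub_fderiv_le_of_norm_iteratedFDeriv_two_le (hVc (x + τ • v))
      (hK (x + τ • v)) c (τ • w)
    rw [map_smul, smul_eq_mul, ← hg_inner, norm_smul, mul_pow, Real.norm_eq_abs, sq_abs] at h2
    have h3 : r τ = (τ * (⟪g (x + τ • v), w⟫ - ⟪g x, w⟫) + K * (τ ^ 2 * ‖w‖ ^ 2)) /
        (τ ^ 2 / 2) := by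
      simp only [r, real_inner_smul_left, inner_sub_left]
      field_simp
    rw [h3, ← add_div, hval]
    gcongr
    linarith
  have hlim : secondSubderiv (valueFun ψ V) c (fun w' => ⟪g x, w'⟫) w ≤
      ((2 * b : ℝ) : EReal) +
        secondSubderiv (fun x' => ψ x' + V x' c) x (fun _ => 0) v := by
    have hr' : limsup (fun τ => (r τ : EReal)) (nhdsWithin (0 : ℝ) (Set.Ioi 0)) =
        ((2 * b : ℝ) : EReal) :=
      ((continuous_coe_real_ereal.tendsto _).comp hr).limsup_eq
    unfold secondSubderiv
    rw [← hr']
    refine le_trans (liminf_le_liminf ?_) (EReal.liminf_add_le ?_ ?_)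
    · filter_upwards [self_mem_nhdsWithin] with τ hτ
      rw [Pi.add_apply, ← EReal.coe_add]
      exact EReal.coe_le_coe (hquot τ hτ)
    · exact .inl (hr' ▸ EReal.coe_ne_bot _)
    · exact .inl (hr' ▸ EReal.coe_ne_top _)
  refine EReal.sub_le_of_le_add ?_
  calc ((1 / 2 : ℝ) : EReal) * secondSubderiv (valueFun ψ V) c (fun w' => ⟪g x, w'⟫) w
      ≤ ((1 / 2 : ℝ) : EReal) * (((2 * b : ℝ) : EReal) +
        secondSubderiv (fun x' => ψ x' + V x' c) x (fun _ => 0) v) :=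
        mul_le_mul_of_nonneg_left hlim (EReal.coe_nonneg.2 (by norm_num))
    _ = _ := by
      rw [EReal.left_distrib_of_nonneg_of_ne_top (EReal.coe_nonneg.2 (by norm_num))
        (EReal.coe_ne_top _), ← EReal.coe_mul, add_comm]
      congr 2
      ring
end
end

section
/- (Slowly varying lower bounds for Birkhoff sums) Let (Ω, P) be a probability space and θ : Ω → Ω an invertible bi-measurable, measure-preserving and ergodic transformation. Let λ₀ : Ω → ℝ be measurable with 0 < λ₀ ≤ 1 almost surely, and set λ = ∫ λ₀ dP. Then for every ε > 0 there exists a measurable function κ₀ : Ω → (0,∞) such that, for P-almost every ω: e^{−ε} ≤ κ₀(θω)/κ₀(ω) ≤ e^{ε}, and for every integer n ≥ 1 both Σ_{k=0}^{n−1} λ₀(θ^k ω) ≥ log κ₀(ω) + n(λ − ε) and Σ_{k=0}^{n−1} λ₀(θ^{−k} ω) ≥ log κ₀(ω) + n(λ − ε). -/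
open MeasureTheory

noncomputable section

open Filter Topology

/-- Birkhoff sums of an integrable function with positive mean are almost surely bounded below. -/
theorem Ergodic.ae_bddBelow_range_birkhoffSum {Ω : Type*} [MeasurableSpace Ω] {P : Measure Ω}
    [IsProbabilityMeasure P] {T : Ω → Ω} (hT : Ergodic T P) {f : Ω → ℝ} (hf : Measurable f)
    (hfi : Integrable f P) (hpos : 0 < ∫ x, f x ∂P) :
    ∀ᵐ ω ∂P, BddBelow (Set.range fun n => birkhoffSum T f n ω) := by
  have hS : ∀ n, Measurable (birkhoffSum T f n) := fun n =>
    Finset.measurable_sum _ fun k _ => hf.comp (hT.measurable.iterate k)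
  set E : Set Ω := {ω | BddBelow (Set.range fun n => birkhoffSum T f n ω)} with hE
  have hEm : MeasurableSet E := measurableSet_bddBelow_range hS
  have hEinv : T ⁻¹' E = E := by
    ext ω
    simp only [hE, Set.mem_preimage, Set.mem_ofPred_eq]
    constructor
    · rintro ⟨c, hc⟩
      refine ⟨min 0 (f ω + c), ?_⟩
      rintro _ ⟨n, rfl⟩
      cases n with
      | zero => simp
      | succ n =>
        have : c ≤ birkhoffSum T f n (T ω) := hc ⟨n, rfl⟩
        simp only [birkhoffSum_succ']
        exact (min_le_right _ _).trans (by linarith)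
    · rintro ⟨c, hc⟩
      refine ⟨c - f ω, ?_⟩
      rintro _ ⟨n, rfl⟩
      have : c ≤ birkhoffSum T f (n + 1) ω := hc ⟨n + 1, rfl⟩
      rw [birkhoffSum_succ'] at this
      change c - f ω ≤ birkhoffSum T f n (T ω)
      linarith
  rcases hT.toPreErgodic.ae_mem_or_ae_notMem hEm hEinv with h | h
  · exact h
  exfalso
  let M : ℕ → Ω → ℝ := fun n => Nat.rec (fun _ => 0) (fun _ m ω => min 0 (f ω + m (T ω))) n
  have hM0 : ∀ ω, M 0 ω = 0 := fun _ => rfl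
  have hMs : ∀ n ω, M (n + 1) ω = min 0 (f ω + M n (T ω)) := fun _ _ => rfl
  have hMnonpos : ∀ n ω, M n ω ≤ 0 := by
    intro n ω
    cases n with
    | zero => exact le_rfl
    | succ n => exact min_le_left _ _
  have hMle : ∀ n, ∀ k ≤ n, ∀ ω, M n ω ≤ birkhoffSum T f k ω := by
    intro n
    induction n with
    | zero =>
      intro k hk ω
      obtain rfl : k = 0 := by omega
      simp [hM0]
    | succ n ih =>
      intro k hk ω
      rw [hMs]
      cases k with
      | zero => simp
      | succ k =>
        rw [birkhoffSum_succ']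
        have := ih k (by omega) (T ω)
        exact (min_le_right _ _).trans (by linarith)
  have hMi : ∀ n, Integrable (M n) P := by
    intro n
    induction n with
    | zero => exact integrable_zero _ _ _
    | succ n ih =>
      exact (integrable_zero _ _ _).inf
        (hfi.add (hT.toMeasurePreserving.integrable_comp_of_integrable ih))
  have hMTi : ∀ n, Integrable (fun ω => M n (T ω)) P := fun n =>
    hT.toMeasurePreserving.integrable_comp_of_integrable (hMi n)
  have hMT : ∀ n, ∫ ω, M n (T ω) ∂P = ∫ ω, M n ω ∂P := by
    intro n
    have := integral_map (μ := P) hT.measurable.aemeasurable (f := M n)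
      (by rw [hT.map_eq]; exact (hMi n).aestronglyMeasurable)
    rw [← this, hT.map_eq]
  have hMmono : ∀ n ω, M (n + 1) ω ≤ M n ω := by
    intro n
    induction n with
    | zero => intro ω; exact hMnonpos 1 ω
    | succ n ih =>
      intro ω
      rw [hMs (n + 1), hMs n]
      have := ih (T ω)
      exact min_le_min le_rfl (by linarith)
  have hdiff : ∀ n ω, M (n + 1) ω - M n (T ω) = min (-M n (T ω)) (f ω) := by
    intro n ω
    rw [hMs, ← min_sub_sub_right]
    congr 1 <;> ring
  have hlim : Tendsto (fun n => ∫ ω, (M (n + 1) ω - M n (T ω)) ∂P) atTop (𝓝 (∫ ω, f ω ∂P)) := by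
    refine tendsto_integral_of_dominated_convergence (fun ω => |f ω|)
      (fun n => ((hMi (n + 1)).sub (hMTi n)).aestronglyMeasurable) hfi.abs ?_ ?_
    · intro n
      refine ae_of_all _ fun ω => ?_
      rw [hdiff, Real.norm_eq_abs]
      have h1 := hMnonpos n (T ω)
      rcases le_total (-M n (T ω)) (f ω) with h2 | h2
      · rw [min_eq_left h2, abs_of_nonneg (by linarith)]
        exact h2.trans (le_abs_self _)
      · rw [min_eq_right h2]
    · filter_upwards [hT.quasiMeasurePreserving.ae h] with ω hω
      have hω' : ∃ k, birkhoffSum T f k (T ω) < -f ω := by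
        by_contra! hcon
        exact hω ⟨-f ω, by rintro _ ⟨k, rfl⟩; exact hcon k⟩
      obtain ⟨k, hk⟩ := hω'
      refine tendsto_const_nhds.congr' ?_
      filter_upwards [eventually_ge_atTop k] with n hn
      have := hMle n k hn (T ω)
      rw [hdiff, min_eq_right (by linarith)]
  have : ∫ ω, f ω ∂P ≤ 0 := by
    refine le_of_tendsto' hlim fun n => ?_
    rw [integral_sub (hMi (n + 1)) (hMTi n), hMT, sub_nonpos]
    exact integral_mono (hMi (n + 1)) (hMi n) (hMmono n)
  linarith

/-- If `g` has mean zero, its Birkhoff sums grow at most at any prescribed linear rate. -/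
theorem Ergodic.ae_exists_abs_birkhoffSum_le {Ω : Type*} [MeasurableSpace Ω] {P : Measure Ω}
    [IsProbabilityMeasure P] {T : Ω → Ω} (hT : Ergodic T P) {g : Ω → ℝ} (hg : Measurable g)
    (hgi : Integrable g P) (hg0 : ∫ x, g x ∂P = 0) {δ : ℝ} (hδ : 0 < δ) :
    ∀ᵐ ω ∂P, ∃ C, ∀ n : ℕ, |birkhoffSum T g n ω| ≤ C + δ * n := by
  have hadd := hT.ae_bddBelow_range_birkhoffSum (f := fun x => δ + g x) (by fun_prop)
    (by fun_prop) (by rw [integral_add (by fun_prop) hgi]; simpa [hg0] using hδ)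
  have hsub := hT.ae_bddBelow_range_birkhoffSum (f := fun x => δ - g x) (by fun_prop)
    (by fun_prop) (by rw [integral_sub (by fun_prop) hgi]; simpa [hg0] using hδ)
  filter_upwards [hadd, hsub] with ω ⟨a, ha⟩ ⟨b, hb⟩
  refine ⟨max (-a) (-b), fun n => abs_le.2 ?_⟩
  have h1 : a ≤ birkhoffSum T (fun x => δ + g x) n ω := ha ⟨n, rfl⟩
  have h2 : b ≤ birkhoffSum T (fun x => δ - g x) n ω := hb ⟨n, rfl⟩
  simp only [birkhoffSum, Finset.sum_add_distrib, Finset.sum_sub_distrib, Finset.sum_const,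
    Finset.card_range, nsmul_eq_mul] at h1 h2 ⊢
  constructor
  · linarith [le_max_left (-a) (-b)]
  · linarith [le_max_right (-a) (-b)]

/-- The Birkhoff cocycle of `g` over a transformation `T` with inverse `Tinv`, indexed by `ℤ`. -/
def intBirkhoffSum {Ω : Type*} (T Tinv : Ω → Ω) (g : Ω → ℝ) : ℤ → Ω → ℝ
  | .ofNat n, ω => birkhoffSum T g n ω
  | .negSucc n, ω => -birkhoffSum Tinv g (n + 1) (Tinv ω)

theorem intBirkhoffSum_apply_map {Ω : Type*} {T Tinv : Ω → Ω} (h : Function.LeftInverse Tinv T)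
    (g : Ω → ℝ) (i : ℤ) (ω : Ω) :
    intBirkhoffSum T Tinv g i (T ω) = intBirkhoffSum T Tinv g (i + 1) ω - g ω := by
  match i with
  | .ofNat n =>
    change birkhoffSum T g n (T ω) = birkhoffSum T g (n + 1) ω - g ω
    rw [birkhoffSum_succ']
    ring
  | .negSucc 0 =>
    change -birkhoffSum Tinv g 1 (Tinv (T ω)) = birkhoffSum T g 0 ω - g ω
    simp [h ω]
  | .negSucc (n + 1) =>
    change -birkhoffSum Tinv g (n + 2) (Tinv (T ω)) =
      -birkhoffSum Tinv g (n + 1) (Tinv ω) - g ω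
    rw [h ω, birkhoffSum_succ']
    ring

theorem intBirkhoffSum_neg_natCast {Ω : Type*} (T Tinv : Ω → Ω) (g : Ω → ℝ) (n : ℕ) (ω : Ω) :
    intBirkhoffSum T Tinv g (-n) ω = -birkhoffSum Tinv g n (Tinv ω) := by
  cases n with
  | zero =>
    change birkhoffSum T g 0 ω = _
    simp
  | succ n => rfl

theorem measurable_intBirkhoffSum {Ω : Type*} [MeasurableSpace Ω] {T Tinv : Ω → Ω}
    (hT : Measurable T) (hTinv : Measurable Tinv) {g : Ω → ℝ} (hg : Measurable g) (i : ℤ) :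
    Measurable (intBirkhoffSum T Tinv g i) := by
  match i with
  | .ofNat n =>
    change Measurable fun ω => birkhoffSum T g n ω
    exact Finset.measurable_sum _ fun k _ => hg.comp (hT.iterate k)
  | .negSucc n =>
    change Measurable fun ω => -birkhoffSum Tinv g (n + 1) (Tinv ω)
    exact (Finset.measurable_sum _ fun k _ => hg.comp ((hTinv.iterate k).comp hTinv)).neg

/-- Shifting a sequence changes its supremum with linear penalty `δ|i|` by at most `δ`. -/
theorem abs_ciSup_shift_sub_le {a : ℤ → ℝ} {δ c : ℝ} (hδ : 0 ≤ δ)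
    (ha : BddAbove (Set.range fun i : ℤ => a i - δ * |(i : ℝ)|)) :
    |(⨆ i : ℤ, (a (i + 1) - c - δ * |(i : ℝ)|)) - ((⨆ i : ℤ, (a i - δ * |(i : ℝ)|)) - c)| ≤ δ := by
  have hup : ∀ i : ℤ, a (i + 1) - c - δ * |(i : ℝ)| ≤
      (⨆ i : ℤ, (a i - δ * |(i : ℝ)|)) - c + δ := by
    intro i
    have h1 := le_ciSup ha (i + 1)
    have h2 : |((i + 1 : ℤ) : ℝ)| ≤ |(i : ℝ)| + 1 := by
      push_cast
      simpa using abs_add_le (i : ℝ) 1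
    nlinarith [mul_le_mul_of_nonneg_left h2 hδ]
  have hb : BddAbove (Set.range fun i : ℤ => a (i + 1) - c - δ * |(i : ℝ)|) :=
    ⟨_, by rintro _ ⟨i, rfl⟩; exact hup i⟩
  have hlow : ∀ i : ℤ, a i - δ * |(i : ℝ)| ≤
      (⨆ i : ℤ, (a (i + 1) - c - δ * |(i : ℝ)|)) + c + δ := by
    intro i
    have h1 := le_ciSup hb (i - 1)
    have h2 : |((i - 1 : ℤ) : ℝ)| ≤ |(i : ℝ)| + 1 := by
      push_cast
      simpa using abs_sub (i : ℝ) 1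
    simp only [sub_add_cancel] at h1
    nlinarith [mul_le_mul_of_nonneg_left h2 hδ]
  have h1 := ciSup_le hup
  have h2 := ciSup_le hlow
  rw [abs_le]
  constructor <;> linarith

/-- **Slowly varying lower bounds for Birkhoff sums.** Let `θ` be an invertible,
bi-measurable, measure-preserving, ergodic transformation of a probability space, and let
`λ₀` be measurable with `0 < λ₀ ≤ 1` a.s., `λ = ∫ λ₀ dP`. Then for every `ε > 0` there is
a measurable `κ₀ : Ω → (0,∞)` such that a.s. `e^{−ε} ≤ κ₀(θω)/κ₀(ω) ≤ e^{ε}` and for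
every `n ≥ 1` both forward and backward Birkhoff sums of `λ₀` of length `n` are at least
`log κ₀(ω) + n(λ − ε)`. -/
theorem slowly_varying_birkhoff_bounds
    (Ω : Type*) [MeasurableSpace Ω] (P : Measure Ω) [IsProbabilityMeasure P]
    (θ θinv : Ω → Ω) (hθ : Measurable θ) (hθinv : Measurable θinv)
    (hli : Function.LeftInverse θinv θ) (hri : Function.RightInverse θinv θ)
    (herg : Ergodic θ P)
    (lam0 : Ω → ℝ) (hmeas : Measurable lam0)
    (hpos : ∀ᵐ ω ∂P, 0 < lam0 ω) (hle1 : ∀ᵐ ω ∂P, lam0 ω ≤ 1)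
    (ε : ℝ) (hε : 0 < ε) :
    ∃ κ : Ω → ℝ, Measurable κ ∧ (∀ ω, 0 < κ ω) ∧
      ∀ᵐ ω ∂P,
        (Real.exp (-ε) ≤ κ (θ ω) / κ ω ∧ κ (θ ω) / κ ω ≤ Real.exp ε) ∧
        ∀ n : ℕ, 1 ≤ n →
          (Real.log (κ ω) + n * ((∫ x, lam0 x ∂P) - ε) ≤
            ∑ k ∈ Finset.range n, lam0 (θ^[k] ω)) ∧
          (Real.log (κ ω) + n * ((∫ x, lam0 x ∂P) - ε) ≤
            ∑ k ∈ Finset.range n, lam0 (θinv^[k] ω)) := by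
  set L := ∫ x, lam0 x ∂P with hL
  let g : Ω → ℝ := fun ω => lam0 ω - L
  have hlami : Integrable lam0 P := by
    refine Integrable.of_bound hmeas.aestronglyMeasurable 1 ?_
    filter_upwards [hpos, hle1] with ω h0 h1
    rwa [Real.norm_eq_abs, abs_of_pos h0]
  have hg : Measurable g := hmeas.sub_const L
  have hgi : Integrable g P := hlami.sub (integrable_const L)
  have hg0 : ∫ x, g x ∂P = 0 := by
    rw [integral_sub hlami (integrable_const L)]
    simp [hL]
  have hsum : ∀ (T : Ω → Ω) (n : ℕ) (ω : Ω),
      ∑ k ∈ Finset.range n, lam0 (T^[k] ω) = birkhoffSum T g n ω + n * L := by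
    intro T n ω
    simp [birkhoffSum, g, Finset.sum_sub_distrib]
  let e : Ω ≃ᵐ Ω := ⟨⟨θ, θinv, hli, hri⟩, hθ, hθinv⟩
  have herg' : Ergodic θinv P := by
    have he : Ergodic e P := herg
    exact he.symm
  have hδ : 0 < ε / 2 := half_pos hε
  let A := intBirkhoffSum θ θinv g
  have hAm : ∀ i, Measurable (A i) := measurable_intBirkhoffSum hθ hθinv hg
  let U : Ω → ℝ := fun ω => ⨆ i : ℤ, (A i ω - ε / 2 * |(i : ℝ)|)
  let V : Ω → ℝ := fun ω => ⨆ i : ℤ, (-A i ω - ε / 2 * |(i : ℝ)|)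
  have hU : Measurable U := Measurable.iSup fun i => (hAm i).sub_const _
  have hV : Measurable V := Measurable.iSup fun i => (hAm i).neg.sub_const _
  refine ⟨fun ω => Real.exp (-(U ω + V ω)), (hU.add hV).neg.exp, fun ω => Real.exp_pos _, ?_⟩
  filter_upwards [herg.ae_exists_abs_birkhoffSum_le hg hgi hg0 hδ,
    herg'.quasiMeasurePreserving.ae (herg'.ae_exists_abs_birkhoffSum_le hg hgi hg0 hδ)]
    with ω ⟨C, hC⟩ ⟨C', hC'⟩
  have hA : ∀ i : ℤ, |A i ω| ≤ max C C' + ε / 2 * |(i : ℝ)| := by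
    intro i
    obtain ⟨n, rfl | rfl⟩ := i.eq_nat_or_neg
    · have := hC n
      change |birkhoffSum θ g n ω| ≤ _
      simp only [Int.cast_natCast, Nat.abs_cast]
      linarith [le_max_left C C']
    · have := hC' n
      simp only [A, intBirkhoffSum_neg_natCast, abs_neg, Int.cast_neg, Int.cast_natCast,
        Nat.abs_cast]
      linarith [le_max_right C C']
  have hbU : BddAbove (Set.range fun i : ℤ => A i ω - ε / 2 * |(i : ℝ)|) := by
    refine ⟨max C C', ?_⟩
    rintro _ ⟨i, rfl⟩
    change A i ω - ε / 2 * |(i : ℝ)| ≤ _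
    linarith [(abs_le.1 (hA i)).2]
  have hbV : BddAbove (Set.range fun i : ℤ => -A i ω - ε / 2 * |(i : ℝ)|) := by
    refine ⟨max C C', ?_⟩
    rintro _ ⟨i, rfl⟩
    change -A i ω - ε / 2 * |(i : ℝ)| ≤ _
    linarith [(abs_le.1 (hA i)).1]
  have hshift : ∀ i, A i (θ ω) = A (i + 1) ω - g ω :=
    fun i => intBirkhoffSum_apply_map hli g i ω
  have hUθ : |U (θ ω) - (U ω - g ω)| ≤ ε / 2 := by
    simpa only [U, hshift] using abs_ciSup_shift_sub_le (c := g ω) hδ.le hbU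
  have hVθ : |V (θ ω) - (V ω - -g ω)| ≤ ε / 2 := by
    have := abs_ciSup_shift_sub_le (a := fun i => -A i ω) (c := -g ω) hδ.le hbV
    simpa only [V, hshift, neg_sub, sub_neg_eq_add, neg_add_eq_sub] using this
  rw [abs_le] at hUθ hVθ
  have hUle : ∀ i : ℤ, A i ω - ε / 2 * |(i : ℝ)| ≤ U ω := le_ciSup hbU
  have hVle : ∀ i : ℤ, -A i ω - ε / 2 * |(i : ℝ)| ≤ V ω := le_ciSup hbV
  refine ⟨?_, fun n hn => ?_⟩
  · rw [← Real.exp_sub, Real.exp_le_exp, Real.exp_le_exp]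
    constructor <;> linarith
  rw [Real.log_exp, hsum, hsum]
  constructor
  · have h0 := hUle 0
    have h1 := hVle n
    have hA0 : A 0 ω = 0 := birkhoffSum_zero ..
    have hAn : A n ω = birkhoffSum θ g n ω := rfl
    simp only [hA0, hAn, Int.cast_zero, abs_zero, Int.cast_natCast, Nat.abs_cast] at h0 h1
    nlinarith [mul_nonneg hε.le (Nat.cast_nonneg (α := ℝ) n)]
  · obtain ⟨m, rfl⟩ : ∃ m, n = m + 1 := ⟨n - 1, by omega⟩
    have h0 := hUle (-m)
    have h1 := hVle 1
    have hA1 : A 1 ω = g ω := birkhoffSum_one ..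
    have hAm' : A (-m) ω = -birkhoffSum θinv g m (θinv ω) := intBirkhoffSum_neg_natCast ..
    simp only [hA1, hAm', Int.cast_one, abs_one, Int.cast_neg, Int.cast_natCast, abs_neg,
      Nat.abs_cast] at h0 h1
    rw [birkhoffSum_succ']
    push_cast
    nlinarith [mul_nonneg hε.le (Nat.cast_nonneg (α := ℝ) m)]
end
end

section
/- (Subexponentially decaying radii dominated by a slowly varying function) Let (Ω, P) be a probability space and θ : Ω → Ω an invertible bi-measurable, measure-preserving and ergodic transformation. Let λ₀ : Ω → ℝ be measurable with 0 < λ₀ ≤ 1 almost surely, set λ = ∫ λ₀ dP, and let 0 < ε < λ/2. Then for every measurable R : Ω → (0,∞) satisfying e^{−ε} ≤ R(θω)/R(ω) ≤ e^{ε} for a.e. ω, there exists a measurable ρ₀ : Ω → (0,∞) with e^{−2ε} ≤ ρ₀(θω)/ρ₀(ω) ≤ e^{2ε} for a.e. ω, such that for a.e. ω and every integer j ≤ −1: ρ₀(ω)·exp( −(1/4) Σ_{k=j}^{−1} λ₀(θ^k ω) ) ≤ R(θ^j ω). -/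
open MeasureTheory Filter Topology

noncomputable section

/-- The running maximum `max (0, S₁, …, Sₙ)` of the Birkhoff sums `Sₖ` of `g` along `T`. -/
def birkhoffMax {Ω : Type*} (T : Ω → Ω) (g : Ω → ℝ) : ℕ → Ω → ℝ
  | 0, _ => 0
  | n + 1, ω => max 0 (g ω + birkhoffMax T g n (T ω))

section BirkhoffMax

variable {Ω : Type*} {T : Ω → Ω} {g : Ω → ℝ}

lemma birkhoffMax_nonneg (n : ℕ) (ω : Ω) : 0 ≤ birkhoffMax T g n ω := by
  cases n with
  | zero => exact le_rfl
  | succ n => exact le_max_left _ _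

lemma birkhoffSum_le_birkhoffMax (n : ℕ) (ω : Ω) :
    birkhoffSum T g n ω ≤ birkhoffMax T g n ω := by
  induction n generalizing ω with
  | zero => simp [birkhoffMax]
  | succ n ih =>
    rw [birkhoffSum_succ']
    exact (add_le_add le_rfl (ih _)).trans (le_max_right _ _)

lemma birkhoffMax_le_succ (n : ℕ) (ω : Ω) :
    birkhoffMax T g n ω ≤ birkhoffMax T g (n + 1) ω := by
  induction n generalizing ω with
  | zero => exact le_max_left _ _
  | succ n ih => exact max_le_max le_rfl (add_le_add le_rfl (ih _))

lemma birkhoffMax_monotone (ω : Ω) : Monotone fun n => birkhoffMax T g n ω :=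
  monotone_nat_of_le_succ fun n => birkhoffMax_le_succ n ω

lemma bddAbove_range_birkhoffMax_comp_iff (ω : Ω) :
    BddAbove (Set.range fun n => birkhoffMax T g n (T ω)) ↔
      BddAbove (Set.range fun n => birkhoffMax T g n ω) := by
  constructor
  · rintro ⟨C, hC⟩
    refine ⟨max 0 (g ω + C), ?_⟩
    rintro _ ⟨n, rfl⟩
    refine (birkhoffMax_le_succ n ω).trans (max_le_max le_rfl ?_)
    exact add_le_add le_rfl (hC ⟨n, rfl⟩)
  · rintro ⟨C, hC⟩
    refine ⟨C - g ω, ?_⟩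
    rintro _ ⟨n, rfl⟩
    have h1 : birkhoffMax T g (n + 1) ω ≤ C := hC ⟨n + 1, rfl⟩
    have h2 : g ω + birkhoffMax T g n (T ω) ≤ birkhoffMax T g (n + 1) ω := le_max_right _ _
    show birkhoffMax T g n (T ω) ≤ C - g ω
    linarith

variable [MeasurableSpace Ω] {P : Measure Ω}

lemma measurable_birkhoffMax (hT : Measurable T) (hg : Measurable g) (n : ℕ) :
    Measurable (birkhoffMax T g n) := by
  induction n with
  | zero => exact measurable_const
  | succ n ih => exact measurable_const.max (hg.add (ih.comp hT))

lemma integrable_birkhoffMax (hT : MeasurePreserving T P P) (hg : Integrable g P) (n : ℕ) :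
    Integrable (birkhoffMax T g n) P := by
  induction n with
  | zero => exact integrable_zero _ _ _
  | succ n ih => exact (integrable_zero _ _ _).sup (hg.add (hT.integrable_comp_of_integrable ih))

end BirkhoffMax

lemma MeasureTheory.MeasurePreserving.integral_comp_of_measurable {Ω : Type*} [MeasurableSpace Ω]
    {P : Measure Ω} {T : Ω → Ω} (hT : MeasurePreserving T P P) {f : Ω → ℝ} (hf : Measurable f) :
    ∫ ω, f (T ω) ∂P = ∫ ω, f ω ∂P := by
  conv_rhs => rw [← hT.map_eq]
  rw [integral_map hT.measurable.aemeasurable hf.aestronglyMeasurable]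

/-- Birkhoff sums of a function with negative mean along an ergodic map are almost surely
bounded above. -/
theorem Ergodic.ae_bddAbove_birkhoffSum {Ω : Type*} [MeasurableSpace Ω] {P : Measure Ω}
    [IsProbabilityMeasure P] {T : Ω → Ω} (hT : Ergodic T P) {g : Ω → ℝ} (hg : Measurable g)
    (hgi : Integrable g P) (hneg : ∫ ω, g ω ∂P < 0) :
    ∀ᵐ ω ∂P, ∃ C, ∀ n, birkhoffSum T g n ω ≤ C := by
  set M := birkhoffMax T g
  have hmp := hT.toMeasurePreserving
  set B : Set Ω := {ω | BddAbove (Set.range fun n => M n ω)}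
  have hBm : MeasurableSet B :=
    measurableSet_bddAbove_range fun n => measurable_birkhoffMax hT.measurable hg n
  have hinv : T ⁻¹' B = B := by
    ext ω
    exact bddAbove_range_birkhoffMax_comp_iff ω
  rcases hT.toPreErgodic.ae_mem_or_ae_notMem hBm hinv with h | h
  · filter_upwards [h] with ω hω
    obtain ⟨C, hC⟩ := hω
    exact ⟨C, fun n => (birkhoffSum_le_birkhoffMax n ω).trans (hC ⟨n, rfl⟩)⟩
  · exfalso
    have hMm (n : ℕ) : Measurable (M n) := measurable_birkhoffMax hT.measurable hg n
    have hMi (n : ℕ) : Integrable (M n) P := integrable_birkhoffMax hmp hgi n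
    have key (n : ℕ) (ω : Ω) : M (n + 1) ω - M n (T ω) = max (-M n (T ω)) (g ω) := by
      change max 0 (g ω + M n (T ω)) - M n (T ω) = _
      rw [max_sub_sub_right 0 _ (M n (T ω)) |>.symm]
      simp
    have hlim : Tendsto (fun n => ∫ ω, (M (n + 1) ω - M n (T ω)) ∂P) atTop
        (𝓝 (∫ ω, g ω ∂P)) := by
      refine tendsto_integral_of_dominated_convergence (fun ω => |g ω|) (fun n => ?_) hgi.abs
        (fun n => ?_) ?_
      · exact ((hMm _).sub ((hMm n).comp hT.measurable)).aestronglyMeasurable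
      · refine Eventually.of_forall fun ω => ?_
        rw [key, Real.norm_eq_abs, abs_le]
        have := birkhoffMax_nonneg (T := T) (g := g) n (T ω)
        exact ⟨(neg_abs_le _).trans (le_max_right _ _),
          max_le ((neg_nonpos.2 this).trans (abs_nonneg _)) (le_abs_self _)⟩
      · filter_upwards [h] with ω hω
        have hω' : ¬ BddAbove (Set.range fun n => M n (T ω)) := fun hb =>
          hω ((bddAbove_range_birkhoffMax_comp_iff ω).1 hb)
        have ht := tendsto_atTop_atTop_of_monotone' (birkhoffMax_monotone (T ω)) hω'
        refine tendsto_const_nhds.congr' ?_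
        filter_upwards [ht.eventually_ge_atTop (-g ω)] with n hn
        rw [key, max_eq_right]
        exact neg_le.1 hn
    refine hneg.not_ge (ge_of_tendsto' hlim fun n => ?_)
    have hMT : Integrable (fun ω => M n (T ω)) P := hmp.integrable_comp_of_integrable (hMi n)
    rw [integral_sub (hMi _) hMT,
      hmp.integral_comp_of_measurable (hMm n), sub_nonneg]
    exact integral_mono (hMi _) (hMi _) fun ω => birkhoffMax_le_succ n ω

/-- A bounded coboundary has mean zero, even if the transfer function is not integrable. -/
theorem MeasureTheory.MeasurePreserving.integral_coboundary_eq_zero {Ω : Type*}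
    [MeasurableSpace Ω] {P : Measure Ω} [IsProbabilityMeasure P] {T : Ω → Ω}
    (hT : MeasurePreserving T P P) {b : Ω → ℝ} (hb : Measurable b) {K : ℝ}
    (hK : ∀ᵐ ω ∂P, |b ω - b (T ω)| ≤ K) : ∫ ω, (b ω - b (T ω)) ∂P = 0 := by
  set c : ℕ → Ω → ℝ := fun N ω => max (-N) (min N (b ω)) with hc
  have hcm (N : ℕ) : Measurable (c N) := measurable_const.max (measurable_const.min hb)
  have hcb (N : ℕ) (ω : Ω) : |c N ω| ≤ N := by
    have : (0 : ℝ) ≤ N := N.cast_nonneg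
    exact abs_le.2 ⟨le_max_left _ _, max_le (by linarith) (min_le_left _ _)⟩
  have hci (N : ℕ) : Integrable (c N) P :=
    Integrable.of_bound (hcm N).aestronglyMeasurable N (Eventually.of_forall (hcb N))
  have hcl (ω : Ω) : ∀ᶠ N : ℕ in atTop, c N ω = b ω := by
    filter_upwards [tendsto_natCast_atTop_atTop.eventually_ge_atTop |b ω|] with N hN
    have := abs_le.1 hN
    simp only [hc]
    rw [min_eq_right this.2, max_eq_right this.1]
  have hlim : Tendsto (fun N => ∫ ω, (c N ω - c N (T ω)) ∂P) atTop
      (𝓝 (∫ ω, (b ω - b (T ω)) ∂P)) := by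
    refine tendsto_integral_of_dominated_convergence (fun _ => K) (fun N => ?_)
      (integrable_const K) (fun N => ?_) (Eventually.of_forall fun ω => ?_)
    · exact ((hcm N).sub ((hcm N).comp hT.measurable)).aestronglyMeasurable
    · filter_upwards [hK] with ω hω
      refine le_trans ?_ hω
      simp only [hc, Real.norm_eq_abs]
      refine (abs_max_sub_max_le_max _ _ _ _).trans (max_le (by simp) ?_)
      exact (abs_min_sub_min_le_max _ _ _ _).trans (max_le (by simp) le_rfl)
    · refine tendsto_const_nhds.congr' ?_
      filter_upwards [hcl ω, hcl (T ω)] with N h1 h2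
      rw [h1, h2]
  refine tendsto_nhds_unique hlim (tendsto_const_nhds.congr fun N => ?_)
  have hcT : Integrable (fun ω => c N (T ω)) P := hT.integrable_comp_of_integrable (hci N)
  rw [integral_sub (hci N) hcT,
    hT.integral_comp_of_measurable (hcm N), sub_self]

/-- A function with bounded increments along an ergodic map decreases sublinearly: its orbit
values are bounded below by any linear function of negative slope, up to a constant. -/
theorem Ergodic.ae_sublinear_lower_bound {Ω : Type*} [MeasurableSpace Ω] {P : Measure Ω}
    [IsProbabilityMeasure P] {T : Ω → Ω} (hT : Ergodic T P) {b : Ω → ℝ} (hb : Measurable b)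
    {K : ℝ} (hK : ∀ᵐ ω ∂P, |b ω - b (T ω)| ≤ K) {δ : ℝ} (hδ : 0 < δ) :
    ∀ᵐ ω ∂P, ∃ C, ∀ n : ℕ, -C - δ * n ≤ b (T^[n] ω) := by
  have hm : Measurable fun ω => b ω - b (T ω) := hb.sub (hb.comp hT.measurable)
  have hi : Integrable (fun ω => b ω - b (T ω)) P :=
    Integrable.of_bound hm.aestronglyMeasurable K hK
  have h0 := hT.toMeasurePreserving.integral_coboundary_eq_zero hb hK
  filter_upwards [hT.ae_bddAbove_birkhoffSum (hm.sub_const δ) (hi.sub (integrable_const δ))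
    (by rw [integral_sub hi (integrable_const δ), h0]; simpa using hδ)] with ω hω
  obtain ⟨C, hC⟩ := hω
  refine ⟨C - b ω, fun n => ?_⟩
  have hsum : birkhoffSum T (fun ω => b ω - b (T ω) - δ) n ω = b ω - b (T^[n] ω) - δ * n := by
    induction n with
    | zero => simp
    | succ n ih =>
      rw [birkhoffSum_succ, ih, Function.iterate_succ_apply']
      push_cast
      ring
  have := hC n
  rw [hsum] at this
  linarith

/-- Birkhoff sums of a bounded function along an ergodic map stay within a sublinear error of
their mean growth. -/
theorem Ergodic.ae_abs_birkhoffSum_sub_le {Ω : Type*} [MeasurableSpace Ω] {P : Measure Ω}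
    [IsProbabilityMeasure P] {T : Ω → Ω} (hT : Ergodic T P) {f : Ω → ℝ} (hf : Measurable f)
    (hfi : Integrable f P) {δ : ℝ} (hδ : 0 < δ) :
    ∀ᵐ ω ∂P, ∃ C, ∀ n : ℕ, |birkhoffSum T f n ω - (∫ x, f x ∂P) * n| ≤ C + δ * n := by
  set L := ∫ x, f x ∂P with hL
  have h1 := hT.ae_bddAbove_birkhoffSum (hf.sub_const (L + δ)) (hfi.sub (integrable_const _))
    (by rw [integral_sub hfi (integrable_const _), ← hL]; simpa using hδ)
  have h2 := hT.ae_bddAbove_birkhoffSum (hf.const_sub (L - δ)) ((integrable_const _).sub hfi)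
    (by rw [integral_sub (integrable_const _) hfi, ← hL]; simpa using hδ)
  filter_upwards [h1, h2] with ω ⟨C₁, hC₁⟩ ⟨C₂, hC₂⟩
  refine ⟨max C₁ C₂, fun n => ?_⟩
  have e1 := hC₁ n
  have e2 := hC₂ n
  simp only [birkhoffSum, Finset.sum_sub_distrib, Finset.sum_const, Finset.card_range,
    nsmul_eq_mul] at e1 e2 ⊢
  have := le_max_left C₁ C₂
  have := le_max_right C₁ C₂
  rw [abs_le]
  constructor <;> linarith

lemma sub_mul_le_of_abs_sub_le {x : ℤ → ℝ} {ε : ℝ} (hx : ∀ k, |x (k + 1) - x k| ≤ ε) (k : ℕ) :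
    x 0 - ε * k ≤ x k := by
  induction k with
  | zero => simp
  | succ k ih =>
    have := (abs_le.1 (hx k)).1
    push_cast
    linarith

/-- Lower bound, uniform in the base point `n` up to the penalty `2 ε |n|`, for a slowly varying
sequence plus a quarter of the sums of a nonnegative sequence of backward density `L > 2 ε`. -/
lemma exists_lower_bound_add_sum {x l : ℤ → ℝ} {ε L C₁ C₂ : ℝ} (hε : 0 < ε) (hL : ε < L / 2)
    (hx : ∀ k, |x (k + 1) - x k| ≤ ε) (hl : ∀ k, 0 ≤ l k)
    (hx' : ∀ k : ℕ, -C₁ - ε / 4 * k ≤ x (-k))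
    (hl' : ∀ k : ℕ, |∑ i ∈ Finset.range k, l (-(i + 1)) - L * k| ≤ C₂ + ε / 4 * k) :
    ∃ C, ∀ (n : ℤ) (m : ℕ),
      C ≤ x (n - m) + 1 / 4 * ∑ i ∈ Finset.range m, l (n - (i + 1)) + 2 * ε * |(n : ℝ)| := by
  have hback (p m : ℕ) : -|C₁| - |C₂| ≤ x (-p - m) +
      1 / 4 * ∑ i ∈ Finset.range m, l (-p - (i + 1)) + 2 * ε * p := by
    have hsum : ∑ i ∈ Finset.range (p + m), l (-(i + 1)) =
        ∑ i ∈ Finset.range p, l (-(i + 1)) + ∑ i ∈ Finset.range m, l (-p - (i + 1)) := by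
      rw [Finset.sum_range_add]
      congr 1
      refine Finset.sum_congr rfl fun i _ => ?_
      congr 1
      push_cast
      ring
    have h1 := hx' (p + m)
    have h2 := (abs_le.1 (hl' (p + m))).1
    have h3 := (abs_le.1 (hl' p)).2
    rw [hsum] at h2
    push_cast at h1 h2
    rw [neg_add'] at h1
    have hp : (0 : ℝ) ≤ p := p.cast_nonneg
    have hm : (0 : ℝ) ≤ m := m.cast_nonneg
    have hεp := mul_nonneg hε.le hp
    have hεm := mul_nonneg hε.le hm
    have hLm : 2 * ε * m ≤ L * m := mul_le_mul_of_nonneg_right (by linarith) hm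
    have := le_abs_self C₁
    have := le_abs_self C₂
    have := abs_nonneg C₂
    linarith
  refine ⟨min (x 0) (-|C₁| - |C₂|), fun n m => ?_⟩
  have hnn (s : Finset ℕ) : 0 ≤ ∑ i ∈ s, l (n - (i + 1)) := Finset.sum_nonneg fun i _ => hl _
  rcases le_total n 0 with hn | hn
  · obtain ⟨p, rfl⟩ : ∃ p : ℕ, n = -p := ⟨n.natAbs, by omega⟩
    refine (min_le_right _ _).trans ((hback p m).trans_eq ?_)
    simp
  · lift n to ℕ using hn
    have hεn : 0 ≤ ε * (n : ℝ) := mul_nonneg hε.le n.cast_nonneg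
    have habs : |((n : ℤ) : ℝ)| = n := by simp
    rw [habs]
    rcases le_total m n with hmn | hmn
    · obtain ⟨q, rfl⟩ := Nat.exists_eq_add_of_le hmn
      have h1 := sub_mul_le_of_abs_sub_le hx q
      have h2 := hnn (Finset.range m)
      have h3 : ((m + q : ℕ) : ℤ) - m = q := by push_cast; ring
      rw [h3]
      refine (min_le_left _ _).trans ?_
      have hεm : 0 ≤ ε * (m : ℝ) := mul_nonneg hε.le m.cast_nonneg
      have hεq : 0 ≤ ε * (q : ℝ) := mul_nonneg hε.le q.cast_nonneg
      push_cast at h2 ⊢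
      linarith
    · obtain ⟨q, rfl⟩ := Nat.exists_eq_add_of_le hmn
      have h1 := hback 0 q
      have h2 := hnn (Finset.range n)
      have h3 : (n : ℤ) - (n + q : ℕ) = -((0 : ℕ) : ℤ) - q := by push_cast; ring
      have h4 (i : ℕ) : (n : ℤ) - ((n + i : ℕ) + 1) = -((0 : ℕ) : ℤ) - (i + 1) := by
        push_cast; ring
      rw [h3, Finset.sum_range_add]
      simp only [h4]
      refine (min_le_right _ _).trans ?_
      simp only [Nat.cast_zero, mul_zero, add_zero] at h1 ⊢
      linarith

/-- The infimum of a family of functions with a penalty `c |n|` for moving `n` steps along the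
orbit of `σ` varies by at most `c` along each step, wherever it is finite. -/
lemma abs_iInf_orbit_sub_le {Ω : Type*} (σ : Equiv.Perm Ω) (g : ℕ → Ω → ℝ) {c : ℝ} (hc : 0 ≤ c)
    {ω : Ω} (hbdd : BddBelow (Set.range fun q : ℤ × ℕ => g q.2 ((σ ^ q.1) ω) + c * |(q.1 : ℝ)|)) :
    |(⨅ q : ℤ × ℕ, (g q.2 ((σ ^ q.1) (σ ω)) + c * |(q.1 : ℝ)|)) -
      ⨅ q : ℤ × ℕ, (g q.2 ((σ ^ q.1) ω) + c * |(q.1 : ℝ)|)| ≤ c := by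
  have hσ (n : ℤ) : (σ ^ n) (σ ω) = (σ ^ (n + 1)) ω := by
    rw [zpow_add_one, Equiv.Perm.mul_apply]
  have hlow (q : ℤ × ℕ) : (⨅ q : ℤ × ℕ, (g q.2 ((σ ^ q.1) ω) + c * |(q.1 : ℝ)|)) - c ≤
      g q.2 ((σ ^ q.1) (σ ω)) + c * |(q.1 : ℝ)| := by
    have h1 := ciInf_le hbdd (q.1 + 1, q.2)
    have h2 : |((q.1 + 1 : ℤ) : ℝ)| ≤ |(q.1 : ℝ)| + 1 := by
      push_cast
      simpa using abs_add_le (q.1 : ℝ) 1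
    have h3 := mul_le_mul_of_nonneg_left h2 hc
    rw [hσ]
    dsimp only at h1
    linarith
  have hbdd' : BddBelow
      (Set.range fun q : ℤ × ℕ => g q.2 ((σ ^ q.1) (σ ω)) + c * |(q.1 : ℝ)|) :=
    ⟨_, Set.forall_mem_range.2 hlow⟩
  have hup (q : ℤ × ℕ) : (⨅ q : ℤ × ℕ, (g q.2 ((σ ^ q.1) (σ ω)) + c * |(q.1 : ℝ)|)) - c ≤
      g q.2 ((σ ^ q.1) ω) + c * |(q.1 : ℝ)| := by
    have h1 := ciInf_le hbdd' (q.1 - 1, q.2)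
    have h2 : |((q.1 - 1 : ℤ) : ℝ)| ≤ |(q.1 : ℝ)| + 1 := by
      push_cast
      simpa using abs_sub (q.1 : ℝ) 1
    have h3 := mul_le_mul_of_nonneg_left h2 hc
    dsimp only at h1
    rw [hσ, sub_add_cancel] at h1
    linarith
  have := le_ciInf hlow
  have := le_ciInf hup
  rw [abs_le]
  constructor <;> linarith

lemma measurePreserving_perm_zpow {Ω : Type*} [MeasurableSpace Ω] {P : Measure Ω}
    {σ : Equiv.Perm Ω} (h : MeasurePreserving σ P P) (h' : MeasurePreserving σ.symm P P) (n : ℤ) :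
    MeasurePreserving (⇑(σ ^ n)) P P := by
  cases n with
  | ofNat n => simpa [Equiv.Perm.coe_pow] using h.iterate n
  | negSucc n =>
    rw [zpow_negSucc, ← inv_pow, Equiv.Perm.coe_pow]
    exact h'.iterate (n + 1)

/-- **Subexponentially decaying radii dominated by a slowly varying function.** In the
setting of an invertible ergodic transformation `θ` of a probability space, with `λ₀`
measurable, `0 < λ₀ ≤ 1` a.s., `λ = ∫ λ₀ dP` and `0 < ε < λ/2`: for every measurable
`R : Ω → (0,∞)` with `e^{−ε} ≤ R(θω)/R(ω) ≤ e^{ε}` a.e., there exists a measurable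
`ρ₀ : Ω → (0,∞)` with `e^{−2ε} ≤ ρ₀(θω)/ρ₀(ω) ≤ e^{2ε}` a.e., such that a.e. and for all
integers `j ≤ −1`: `ρ₀(ω)·exp(−¼ Σ_{k=j}^{−1} λ₀(θ^k ω)) ≤ R(θ^j ω)`. -/
theorem subexponential_radii_dominated
    (Ω : Type*) [MeasurableSpace Ω] (P : Measure Ω) [IsProbabilityMeasure P]
    (θ θinv : Ω → Ω) (hθ : Measurable θ) (hθinv : Measurable θinv)
    (hli : Function.LeftInverse θinv θ) (hri : Function.RightInverse θinv θ)
    (herg : Ergodic θ P)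
    (lam0 : Ω → ℝ) (hmeas : Measurable lam0)
    (hpos : ∀ᵐ ω ∂P, 0 < lam0 ω) (hle1 : ∀ᵐ ω ∂P, lam0 ω ≤ 1)
    (ε : ℝ) (hε : 0 < ε) (hε2 : ε < (∫ x, lam0 x ∂P) / 2)
    (R : Ω → ℝ) (hRmeas : Measurable R) (hRpos : ∀ ω, 0 < R ω)
    (hRslow : ∀ᵐ ω ∂P,
      Real.exp (-ε) ≤ R (θ ω) / R ω ∧ R (θ ω) / R ω ≤ Real.exp ε) :
    ∃ ρ₀ : Ω → ℝ, Measurable ρ₀ ∧ (∀ ω, 0 < ρ₀ ω) ∧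
      ∀ᵐ ω ∂P,
        (Real.exp (-(2 * ε)) ≤ ρ₀ (θ ω) / ρ₀ ω ∧ ρ₀ (θ ω) / ρ₀ ω ≤ Real.exp (2 * ε)) ∧
        ∀ m : ℕ, 1 ≤ m →
          ρ₀ ω * Real.exp (-(1 / 4) * ∑ i ∈ Finset.Icc 1 m, lam0 (θinv^[i] ω)) ≤
            R (θinv^[m] ω) := by
  set σ : Equiv.Perm Ω := ⟨θ, θinv, hli, hri⟩
  have hT : Ergodic θinv P := Ergodic.symm (e := ⟨σ, hθ, hθinv⟩) herg
  have hmp (n : ℤ) : MeasurePreserving (⇑(σ ^ n)) P P :=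
    measurePreserving_perm_zpow (σ := σ) herg.toMeasurePreserving hT.toMeasurePreserving n
  have horbit {Q : Ω → Prop} (hQ : ∀ᵐ ω ∂P, Q ω) : ∀ᵐ ω ∂P, ∀ n : ℤ, Q ((σ ^ n) ω) :=
    ae_all_iff.2 fun n => (hmp n).quasiMeasurePreserving.ae hQ
  have hθσ (ω : Ω) (n : ℤ) : θ ((σ ^ n) ω) = (σ ^ (n + 1)) ω := by
    rw [add_comm, zpow_one_add, Equiv.Perm.mul_apply]
    rfl
  have hiter (ω : Ω) (n : ℤ) (m : ℕ) : θinv^[m] ((σ ^ n) ω) = (σ ^ (n - m)) ω := by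
    have h : (⇑(σ ^ (-(m : ℤ))) : Ω → Ω) = θinv^[m] := by
      rw [zpow_neg, zpow_natCast, ← inv_pow, Equiv.Perm.coe_pow]
      rfl
    rw [← h, ← Equiv.Perm.mul_apply, ← zpow_add, neg_add_eq_sub]
  have hiter0 (ω : Ω) (m : ℕ) : θinv^[m] ω = (σ ^ (-(m : ℤ))) ω := by
    simpa using hiter ω 0 m
  set r : Ω → ℝ := fun ω => Real.log (R ω) with hr
  have hrm : Measurable r := Real.measurable_log.comp hRmeas
  have hrslow : ∀ᵐ ω ∂P, |r (θ ω) - r ω| ≤ ε := by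
    filter_upwards [hRslow] with ω hω
    rw [hr]
    dsimp only
    rw [← Real.log_div (hRpos _).ne' (hRpos _).ne', abs_le]
    have hq := div_pos (hRpos (θ ω)) (hRpos ω)
    exact ⟨(Real.le_log_iff_exp_le hq).2 hω.1, (Real.log_le_iff_le_exp hq).2 hω.2⟩
  have hrback : ∀ᵐ ω ∂P, |r ω - r (θinv ω)| ≤ ε := by
    filter_upwards [hT.quasiMeasurePreserving.ae hrslow] with ω hω
    rwa [hri ω] at hω
  have hint : Integrable (fun ω => lam0 (θinv ω)) P := by
    refine hT.toMeasurePreserving.integrable_comp_of_integrable (g := lam0) ?_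
    refine Integrable.of_bound hmeas.aestronglyMeasurable 1 ?_
    filter_upwards [hpos, hle1] with ω h0 h1
    rwa [Real.norm_eq_abs, abs_of_pos h0]
  set g : ℕ → Ω → ℝ := fun m ω =>
    r (θinv^[m] ω) + 1 / 4 * ∑ i ∈ Finset.Icc 1 m, lam0 (θinv^[i] ω) with hg
  have hgσ (m : ℕ) (n : ℤ) (ω : Ω) : g m ((σ ^ n) ω) = r ((σ ^ (n - m)) ω) +
      1 / 4 * ∑ i ∈ Finset.range m, lam0 ((σ ^ (n - (i + 1))) ω) := by
    simp only [hg, hiter]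
    have hIcc : Finset.Icc 1 m = Finset.Ico (0 + 1) (m + 1) := by
      ext i
      simp only [Finset.mem_Icc, Finset.mem_Ico]
      omega
    rw [Finset.range_eq_Ico, hIcc,
      ← Finset.sum_Ico_add' (fun i : ℕ => lam0 ((σ ^ (n - i)) ω)) 0 m 1]
    simp
  have hgm (m : ℕ) : Measurable (g m) :=
    (hrm.comp (hθinv.iterate m)).add
      ((Finset.measurable_sum _ fun i _ => hmeas.comp (hθinv.iterate i)).const_mul _)
  set φ : Ω → ℝ := fun ω => ⨅ q : ℤ × ℕ, (g q.2 ((σ ^ q.1) ω) + 2 * ε * |(q.1 : ℝ)|)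
  have hbdd : ∀ᵐ ω ∂P, BddBelow
      (Set.range fun q : ℤ × ℕ => g q.2 ((σ ^ q.1) ω) + 2 * ε * |(q.1 : ℝ)|) := by
    filter_upwards [horbit hrslow, horbit hpos,
      hT.ae_sublinear_lower_bound hrm hrback (δ := ε / 4) (by positivity),
      hT.ae_abs_birkhoffSum_sub_le (hmeas.comp hθinv) hint (δ := ε / 4) (by positivity)]
      with ω h1 h2 ⟨C₁, h3⟩ ⟨C₂, h4⟩
    obtain ⟨C, hC⟩ := exists_lower_bound_add_sum (x := fun n => r ((σ ^ n) ω))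
      (l := fun n => lam0 ((σ ^ n) ω)) (C₁ := C₁) (C₂ := C₂) hε hε2
      (fun k => by simpa only [hθσ] using h1 k) (fun k => (h2 k).le)
      (fun k => by simpa only [hiter0] using h3 k) (fun k => by
        have h := h4 k
        simp only [birkhoffSum, Function.comp_apply,
          hT.toMeasurePreserving.integral_comp_of_measurable hmeas,
          ← Function.iterate_succ_apply' θinv] at h
        simpa only [hiter0, Nat.cast_succ] using h)
    refine ⟨C, ?_⟩
    rintro _ ⟨⟨n, m⟩, rfl⟩
    simpa only [hgσ] using hC n m
  refine ⟨fun ω => Real.exp (φ ω), ?_, fun ω => Real.exp_pos _, ?_⟩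
  · exact Real.measurable_exp.comp (Measurable.iInf fun q =>
      ((hgm q.2).comp (hmp q.1).measurable).add_const _)
  · filter_upwards [hbdd] with ω hω
    have hstep : |φ (θ ω) - φ ω| ≤ 2 * ε := abs_iInf_orbit_sub_le σ g (by positivity) hω
    rw [abs_le] at hstep
    refine ⟨?_, fun m _ => ?_⟩
    · rw [← Real.exp_sub]
      exact ⟨Real.exp_le_exp.2 hstep.1, Real.exp_le_exp.2 hstep.2⟩
    · have h : φ ω ≤ g m ω := by simpa using ciInf_le hω (0, m)
      rw [← Real.exp_add, ← Real.le_log_iff_exp_le (hRpos _)]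
      simp only [hg, hr] at h
      linarith
end
end

section
/- (Smoothness of the action at a disconjugate minimizer) Let (F_j)_{j∈ℤ} be C² ℤ^d-periodic functions on ℝ^d, define Φ_j : ℝ^d × ℝ^d → ℝ^d × ℝ^d by Φ_j(x,v) = (x + v − ∇F_j(x), v − ∇F_j(x)), and Φ_{m,n} = Φ_{n−1} ∘ ⋯ ∘ Φ_m for integers m < n. For x, x' ∈ ℝ^d let Ã_{m,n}(x,x') = inf { Σ_{i=m}^{n−1} ½‖x̃_{i+1} − x̃_i‖² − Σ_{i=m}^{n−1} F_i(x̃_i) } over sequences x̃_m,…,x̃_n ∈ ℝ^d with x̃_m = x and x̃_n = x'. Suppose (x_j, v_j)_{j=m}^n is an orbit (Φ_j(x_j,v_j) = (x_{j+1},v_{j+1})) whose configuration (x_j)_{j=m}^n is the unique sequence attaining the infimum defining Ã_{m,n}(x_m, x_n); suppose the partial derivatives ∂₁Ã_{m,n} and ∂₂Ã_{m,n} exist at (x_m, x_n); and suppose the orbit is disconjugate: for all m ≤ k < l ≤ n, DΦ_{k,l}(x_k,v_k)({0} × ℝ^d) ∩ ({0} × ℝ^d) = {0}. Then Ã_{m,n}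 is C² on a neighbourhood of (x_m, x_n), and writing DΦ_{m,n}(x_m,v_m) in d×d block form as [[𝒜, ℬ],[𝒞, 𝒟]], the block ℬ is invertible and ∂²₂₂Ã_{m,n}(x_m, x_n) = 𝒟ℬ^{−1}, the symmetric matrix whose graph {(δx, 𝒟ℬ^{−1}δx)} equals the subspace DΦ_{m,n}(x_m,v_m)({0} × ℝ^d). -/
open Finset
open scoped RealInnerProductSpace

noncomputable section

/-- The kicked standard map `Φ_j(x,v) = (x + v − ∇F_j(x), v − ∇F_j(x))`. -/
def kick {d : ℕ} (F : ℤ → EuclideanSpace ℝ (Fin d) → ℝ) (j : ℤ)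
    (p : EuclideanSpace ℝ (Fin d) × EuclideanSpace ℝ (Fin d)) :
    EuclideanSpace ℝ (Fin d) × EuclideanSpace ℝ (Fin d) :=
  (p.1 + p.2 - gradient (F j) p.1, p.2 - gradient (F j) p.1)

/-- The composition `Φ_{m+k−1} ∘ ⋯ ∘ Φ_m`; thus `kickComp F m (n−m).toNat = Φ_{m,n}`. -/
def kickComp {d : ℕ} (F : ℤ → EuclideanSpace ℝ (Fin d) → ℝ) (m : ℤ) :
    ℕ → (EuclideanSpace ℝ (Fin d) × EuclideanSpace ℝ (Fin d) →
      EuclideanSpace ℝ (Fin d) × EuclideanSpace ℝ (Fin d))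
  | 0 => id
  | k + 1 => kick F (m + (k : ℤ)) ∘ kickComp F m k

/-- The action of the configuration `γ` on the time interval `[m,n]`:
`Σ_{i=m}^{n-1} (½‖γ(i+1) − γ(i)‖² − F_i(γ(i)))`. -/
def actSum {d : ℕ} (F : ℤ → EuclideanSpace ℝ (Fin d) → ℝ) (m n : ℤ)
    (γ : ℤ → EuclideanSpace ℝ (Fin d)) : ℝ :=
  ∑ i ∈ Finset.Ico m n, ((1 : ℝ) / 2 * ‖γ (i + 1) - γ i‖ ^ 2 - F i (γ i))

/-- The fixed-endpoint action `Ã_{m,n}(x,x')`. -/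
def actInf {d : ℕ} (F : ℤ → EuclideanSpace ℝ (Fin d) → ℝ) (m n : ℤ)
    (x x' : EuclideanSpace ℝ (Fin d)) : ℝ :=
  sInf { a : ℝ | ∃ γ : ℤ → EuclideanSpace ℝ (Fin d), γ m = x ∧ γ n = x' ∧ a = actSum F m n γ }

theorem exists_upper_bound_of_periodic {d : ℕ} {f : EuclideanSpace ℝ (Fin d) → ℝ}
    (hf : Continuous f) (hper : ∀ x v, IsIntVec v → f (x + v) = f x) : ∃ M, ∀ x, f x ≤ M := by
  obtain ⟨M, hM⟩ := (isCompact_closedBall (0 : EuclideanSpace ℝ (Fin d)) (√d)).bddAbove_image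
    hf.continuousOn
  refine ⟨M, fun x => ?_⟩
  let k : EuclideanSpace ℝ (Fin d) := WithLp.toLp 2 fun i => ((-⌊x i⌋ : ℤ) : ℝ)
  rw [← hper x k fun i => ⟨-⌊x i⌋, rfl⟩]
  refine hM ⟨x + k, ?_, rfl⟩
  rw [mem_closedBall_zero_iff, EuclideanSpace.norm_eq]
  apply Real.sqrt_le_sqrt
  calc ∑ i, ‖(x + k) i‖ ^ 2 ≤ ∑ _i : Fin d, (1 : ℝ) := by
        refine Finset.sum_le_sum fun i _ => ?_
        have h : (x + k) i = Int.fract (x i) := by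
          simp [k, Int.fract, sub_eq_add_neg]
        rw [h, Real.norm_eq_abs, sq_abs]
        exact pow_le_one₀ (Int.fract_nonneg _) (Int.fract_lt_one _).le
    _ = d := by simp

section Kick

variable {d : ℕ} {F : ℤ → EuclideanSpace ℝ (Fin d) → ℝ}

theorem contDiff_gradient_of_contDiff_two {f : EuclideanSpace ℝ (Fin d) → ℝ}
    (hf : ContDiff ℝ 2 f) : ContDiff ℝ 1 (gradient f) :=
  (InnerProductSpace.toDual ℝ (EuclideanSpace ℝ (Fin d))).symm.contDiff.comp
    (hf.fderiv_right (m := 1) (by norm_num))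

theorem contDiff_kick (hF : ∀ j, ContDiff ℝ 2 (F j)) (j : ℤ) : ContDiff ℝ 1 (kick F j) := by
  have := (contDiff_gradient_of_contDiff_two (hF j)).comp
    (contDiff_fst (E := EuclideanSpace ℝ (Fin d)) (F := EuclideanSpace ℝ (Fin d)))
  unfold kick
  fun_prop

theorem contDiff_kickComp (hF : ∀ j, ContDiff ℝ 2 (F j)) (m : ℤ) (k : ℕ) :
    ContDiff ℝ 1 (kickComp F m k) := by
  induction k with
  | zero => exact contDiff_id
  | succ k ih => exact (contDiff_kick hF _).comp ih

theorem injective_fderiv_kick (hF : ∀ j, ContDiff ℝ 2 (F j)) (j : ℤ)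
    (p : EuclideanSpace ℝ (Fin d) × EuclideanSpace ℝ (Fin d)) :
    Function.Injective (fderiv ℝ (kick F j) p) := by
  have hg : HasFDerivAt (gradient (F j)) (fderiv ℝ (gradient (F j)) p.1) p.1 :=
    ((contDiff_gradient_of_contDiff_two (hF j)).differentiable one_ne_zero p.1).hasFDerivAt
  have hg1 := hg.comp p hasFDerivAt_fst
  have hk : HasFDerivAt (kick F j) _ p :=
    ((hasFDerivAt_fst.add hasFDerivAt_snd).sub hg1).prodMk (hasFDerivAt_snd.sub hg1)
  rw [hk.fderiv]
  refine (injective_iff_map_eq_zero _).2 ?_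
  rintro ⟨a, b⟩ h
  simp only [ContinuousLinearMap.prod_apply, sub_apply, add_apply,
    ContinuousLinearMap.comp_apply, ContinuousLinearMap.coe_fst', ContinuousLinearMap.coe_snd',
    Prod.mk_eq_zero] at h
  obtain ⟨h1, h2⟩ := h
  have ha : a = 0 := by
    rwa [add_sub_assoc, h2, add_zero] at h1
  subst ha
  simpa using h2

theorem injective_fderiv_kickComp (hF : ∀ j, ContDiff ℝ 2 (F j)) (m : ℤ) (k : ℕ)
    (p : EuclideanSpace ℝ (Fin d) × EuclideanSpace ℝ (Fin d)) :
    Function.Injective (fderiv ℝ (kickComp F m k) p) := by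
  induction k with
  | zero =>
    simp only [kickComp, fderiv_id]
    exact Function.injective_id
  | succ k ih =>
    rw [kickComp, fderiv_comp p ((contDiff_kick hF _).differentiable one_ne_zero _)
      ((contDiff_kickComp hF m k).differentiable one_ne_zero p)]
    exact (injective_fderiv_kick hF _ _).comp ih

theorem kickComp_eq_of_orbit {m : ℤ} {N : ℕ} {x v : ℤ → EuclideanSpace ℝ (Fin d)}
    (horb : ∀ j, m ≤ j → j < m + N → kick F j (x j, v j) = (x (j + 1), v (j + 1)))
    {k : ℕ} (hk : k ≤ N) : kickComp F m k (x m, v m) = (x (m + k), v (m + k)) := by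
  induction k with
  | zero => simp [kickComp]
  | succ k ih =>
    rw [kickComp, Function.comp_apply, ih (by omega), horb _ (by omega) (by omega)]
    push_cast
    rw [add_assoc]

theorem kick_fst_eq_add_snd (j : ℤ) (p : EuclideanSpace ℝ (Fin d) × EuclideanSpace ℝ (Fin d)) :
    (kick F j p).1 - p.1 = (kick F j p).2 := by
  simp only [kick]
  abel

theorem kick_sub_add_gradient (j : ℤ) (a b : EuclideanSpace ℝ (Fin d)) :
    kick F j (a, b - a + gradient (F j) a) = (b, b - a) := by
  simp only [kick, Prod.mk.injEq]
  constructor <;> abel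

theorem actSum_zero (m : ℤ) (γ : ℤ → EuclideanSpace ℝ (Fin d)) :
    actSum F m (m + (0 : ℕ)) γ = 0 := by
  simp [actSum]

theorem actSum_succ (m : ℤ) (k : ℕ) (γ : ℤ → EuclideanSpace ℝ (Fin d)) :
    actSum F m (m + (k + 1 : ℕ)) γ = actSum F m (m + k) γ +
      ((1 : ℝ) / 2 * ‖γ (m + k + 1) - γ (m + k)‖ ^ 2 - F (m + k) (γ (m + k))) := by
  have : Finset.Ico m (m + (k + 1 : ℕ)) = insert (m + (k : ℤ)) (Finset.Ico m (m + k)) := by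
    ext i
    simp only [Finset.mem_Ico, Finset.mem_insert]
    omega
  rw [actSum, this, Finset.sum_insert (by simp), add_comm, actSum]

theorem actSum_congr {m n : ℤ} {γ γ' : ℤ → EuclideanSpace ℝ (Fin d)}
    (h : ∀ i, m ≤ i → i ≤ n → γ i = γ' i) : actSum F m n γ = actSum F m n γ' := by
  refine Finset.sum_congr rfl fun i hi => ?_
  rw [Finset.mem_Ico] at hi
  rw [h i hi.1 hi.2.le, h (i + 1) (by omega) (by omega)]

/-- The configuration of the orbit of `p` started at time `m`. -/
def orbitConfig (F : ℤ → EuclideanSpace ℝ (Fin d) → ℝ) (m : ℤ)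
    (p : EuclideanSpace ℝ (Fin d) × EuclideanSpace ℝ (Fin d)) (i : ℤ) :
    EuclideanSpace ℝ (Fin d) :=
  (kickComp F m (i - m).toNat p).1

theorem orbitConfig_add (m : ℤ) (k : ℕ)
    (p : EuclideanSpace ℝ (Fin d) × EuclideanSpace ℝ (Fin d)) :
    orbitConfig F m p (m + k) = (kickComp F m k p).1 := by
  simp [orbitConfig]

theorem actSum_orbitConfig_succ (m : ℤ) (k : ℕ)
    (p : EuclideanSpace ℝ (Fin d) × EuclideanSpace ℝ (Fin d)) :
    actSum F m (m + (k + 1 : ℕ)) (orbitConfig F m p) = actSum F m (m + k) (orbitConfig F m p) +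
      ((1 : ℝ) / 2 * ‖(kickComp F m (k + 1) p).2‖ ^ 2 - F (m + k) (kickComp F m k p).1) := by
  have h1 : m + (k : ℤ) + 1 = m + (k + 1 : ℕ) := by push_cast; ring
  rw [actSum_succ, h1, orbitConfig_add, orbitConfig_add, kickComp, Function.comp_apply,
    kick_fst_eq_add_snd]

theorem fderiv_kickComp_succ_fst_sub (hF : ∀ j, ContDiff ℝ 2 (F j)) (m : ℤ) (k : ℕ)
    (p δ : EuclideanSpace ℝ (Fin d) × EuclideanSpace ℝ (Fin d)) :
    (fderiv ℝ (kickComp F m (k + 1)) p δ).1 - (fderiv ℝ (kickComp F m k) p δ).1 =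
      (fderiv ℝ (kickComp F m (k + 1)) p δ).2 := by
  have h : ∀ k, HasFDerivAt (kickComp F m k) (fderiv ℝ (kickComp F m k) p) p := fun k =>
    ((contDiff_kickComp hF m k).differentiable one_ne_zero p).hasFDerivAt
  have h1 := (h (k + 1)).fst.sub (h k).fst
  have h2 := (h (k + 1)).snd
  have h3 : (fun q => (kickComp F m (k + 1) q).1) - (fun q => (kickComp F m k q).1) =
      fun q => (kickComp F m (k + 1) q).2 := by
    funext q
    exact kick_fst_eq_add_snd _ _
  rw [h3] at h1
  exact DFunLike.congr_fun (h1.unique h2) δ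

/-- First variation of the action along orbits. -/
theorem hasFDerivAt_actSum_orbitConfig (hF : ∀ j, ContDiff ℝ 2 (F j)) (m : ℤ) (k : ℕ)
    (p : EuclideanSpace ℝ (Fin d) × EuclideanSpace ℝ (Fin d)) :
    HasFDerivAt (fun q => actSum F m (m + k) (orbitConfig F m q))
      ((innerSL ℝ (kickComp F m k p).2).comp
          ((ContinuousLinearMap.fst ℝ _ _).comp (fderiv ℝ (kickComp F m k) p)) -
        (innerSL ℝ p.2).comp (ContinuousLinearMap.fst ℝ _ _)) p := by
  induction k with
  | zero =>
    simp only [actSum_zero]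
    convert hasFDerivAt_const (0 : ℝ) p using 1
    ext δ <;> simp [kickComp]
  | succ k ih =>
    have h : ∀ k, HasFDerivAt (kickComp F m k) (fderiv ℝ (kickComp F m k) p) p := fun k =>
      ((contDiff_kickComp hF m k).differentiable one_ne_zero p).hasFDerivAt
    simp only [actSum_orbitConfig_succ]
    have hFk : HasFDerivAt (F (m + k)) _ (kickComp F m k p).1 :=
      ((hF (m + k)).differentiable two_ne_zero _).hasFDerivAt
    have key := ih.add ((((h (k + 1)).snd.norm_sq).const_mul ((1 : ℝ) / 2)).sub
      (hFk.comp p (h k).fst))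
    refine key.congr_fderiv ?_
    refine ContinuousLinearMap.ext fun δ => ?_
    have h2 := fderiv_kickComp_succ_fst_sub hF m k p δ
    have h3 : (kickComp F m (k + 1) p).2 =
      (kickComp F m k p).2 - gradient (F (m + k)) (kickComp F m k p).1 := rfl
    simp only [add_apply, sub_apply, ContinuousLinearMap.comp_apply,
      smul_apply, ContinuousLinearMap.coe_fst',
      ContinuousLinearMap.coe_snd', innerSL_apply_apply, smul_eq_mul, ← h2,
      ← inner_gradient_left (𝕜 := ℝ)]
    rw [h3]
    simp only [inner_sub_left, inner_sub_right]
    ring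

theorem eulerLagrange_of_minimizer (hF : ∀ j, ContDiff ℝ 2 (F j)) {m n : ℤ}
    {γ : ℤ → EuclideanSpace ℝ (Fin d)}
    (hmin : ∀ γ' : ℤ → EuclideanSpace ℝ (Fin d), γ' m = γ m → γ' n = γ n →
      actSum F m n γ ≤ actSum F m n γ')
    {j : ℤ} (hmj : m < j) (hjn : j < n) :
    γ (j + 1) - γ j + gradient (F j) (γ j) = γ j - γ (j - 1) := by
  have key : ∀ u, ⟪γ j - γ (j - 1), u⟫ - ⟪γ (j + 1) - γ j, u⟫ - ⟪gradient (F j) (γ j), u⟫ = 0 := by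
    intro u
    let η : ℤ → EuclideanSpace ℝ (Fin d) := Pi.single j u
    have hline : ∀ i, HasDerivAt (fun t : ℝ => γ i + t • η i) (η i) 0 := fun i => by
      simpa using ((hasDerivAt_id (0 : ℝ)).smul_const (η i)).const_add (γ i)
    have hder : HasDerivAt (fun t : ℝ => actSum F m n fun i => γ i + t • η i)
        (∑ i ∈ Finset.Ico m n,
          (⟪γ (i + 1) - γ i, η (i + 1) - η i⟫ - ⟪gradient (F i) (γ i), η i⟫)) 0 := by
      refine HasDerivAt.fun_sum fun i _ => ?_
      have h1 := (((hline (i + 1)).sub (hline i)).norm_sq).const_mul ((1 : ℝ) / 2)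
      have hFi : HasFDerivAt (F i) (fderiv ℝ (F i) (γ i)) (γ i + (0 : ℝ) • η i) := by
        rw [zero_smul, add_zero]
        exact ((hF i).differentiable two_ne_zero _).hasFDerivAt
      refine (h1.sub (hFi.comp_hasDerivAt (0 : ℝ) (hline i))).congr_deriv ?_
      rw [inner_gradient_left]
      simp
    have hloc : IsLocalMin (fun t : ℝ => actSum F m n fun i => γ i + t • η i) 0 := by
      refine Filter.Eventually.of_forall fun t => ?_
      simp only [zero_smul, add_zero]
      refine hmin _ ?_ ?_
      · simp [η, Pi.single_eq_of_ne hmj.ne]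
      · simp [η, Pi.single_eq_of_ne hjn.ne']
    have h0 := hloc.hasDerivAt_eq_zero hder
    have hη : ∀ (i : ℤ) (w : EuclideanSpace ℝ (Fin d)), ⟪w, η i⟫ = if i = j then ⟪w, u⟫ else 0 := by
      intro i w
      by_cases h : i = j
      · subst h; simp [η]
      · simp [η, h]
    simp only [inner_sub_right, Finset.sum_sub_distrib, hη, ← eq_sub_iff_add_eq,
      Finset.sum_ite_eq',
      Finset.mem_Ico] at h0
    rw [if_pos ⟨by omega, by omega⟩, if_pos ⟨hmj.le, hjn⟩, if_pos ⟨hmj.le, hjn⟩] at h0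
    simpa using h0
  have h := key (γ j - γ (j - 1) - (γ (j + 1) - γ j) - gradient (F j) (γ j))
  rw [← inner_sub_left, ← inner_sub_left, inner_self_eq_zero] at h
  rw [sub_sub, sub_eq_zero] at h
  exact h.symm

theorem kickComp_fst_of_minimizer (hF : ∀ j, ContDiff ℝ 2 (F j)) {m : ℤ} {N : ℕ}
    {γ : ℤ → EuclideanSpace ℝ (Fin d)}
    (hmin : ∀ γ' : ℤ → EuclideanSpace ℝ (Fin d), γ' m = γ m → γ' (m + N) = γ (m + N) →
      actSum F m (m + N) γ ≤ actSum F m (m + N) γ')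
    {k : ℕ} (hk : k ≤ N) :
    (kickComp F m k (γ m, γ (m + 1) - γ m + gradient (F m) (γ m))).1 = γ (m + k) := by
  have key : ∀ k : ℕ, k < N →
      kickComp F m k (γ m, γ (m + 1) - γ m + gradient (F m) (γ m)) =
        (γ (m + k), γ (m + k + 1) - γ (m + k) + gradient (F (m + k)) (γ (m + k))) := by
    intro k hk
    induction k with
    | zero => simp [kickComp]
    | succ k ih =>
      have he := eulerLagrange_of_minimizer hF hmin (j := m + k + 1) (by omega) (by omega)
      rw [add_sub_cancel_right] at he
      push_cast
      rw [kickComp, Function.comp_apply, ih (by omega), ← add_assoc, he, kick_sub_add_gradient]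
  rcases k with _ | k
  · simp [kickComp]
  · rw [kickComp, Function.comp_apply, key k (by omega)]
    push_cast
    rw [← add_assoc, kick_sub_add_gradient]

theorem continuous_actSum (hF : ∀ j, Continuous (F j)) (m n : ℤ) :
    Continuous (actSum F m n) := by
  unfold actSum
  fun_prop

theorem exists_half_sq_norm_le_actSum_add (hF : ∀ j, Continuous (F j))
    (hFper : ∀ j x v, IsIntVec v → F j (x + v) = F j x) (m n : ℤ) :
    ∃ C : ℝ, ∀ (γ : ℤ → EuclideanSpace ℝ (Fin d)), ∀ i ∈ Finset.Ico m n,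
      (1 : ℝ) / 2 * ‖γ (i + 1) - γ i‖ ^ 2 ≤ actSum F m n γ + C := by
  choose M hM using fun j => exists_upper_bound_of_periodic (hF j) (hFper j)
  refine ⟨∑ i ∈ Finset.Ico m n, M i, fun γ i hi => ?_⟩
  rw [actSum, ← Finset.sum_add_distrib]
  refine le_trans ?_ (Finset.single_le_sum (f := fun i =>
    (1 : ℝ) / 2 * ‖γ (i + 1) - γ i‖ ^ 2 - F i (γ i) + M i) (fun j _ => ?_) hi)
  · linarith [hM i (γ i)]
  · have : 0 ≤ (1 : ℝ) / 2 * ‖γ (j + 1) - γ j‖ ^ 2 := by positivity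
    linarith [hM j (γ j)]

theorem bddBelow_actSum (hF : ∀ j, Continuous (F j))
    (hFper : ∀ j x v, IsIntVec v → F j (x + v) = F j x) {m n : ℤ} (hmn : m < n)
    (x x' : EuclideanSpace ℝ (Fin d)) :
    BddBelow { a : ℝ | ∃ γ : ℤ → EuclideanSpace ℝ (Fin d),
      γ m = x ∧ γ n = x' ∧ a = actSum F m n γ } := by
  obtain ⟨C, hC⟩ := exists_half_sq_norm_le_actSum_add hF hFper m n
  refine ⟨-C, ?_⟩
  rintro a ⟨γ, -, -, rfl⟩
  have h := hC γ m (Finset.mem_Ico.2 ⟨le_rfl, hmn⟩)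
  have : 0 ≤ (1 : ℝ) / 2 * ‖γ (m + 1) - γ m‖ ^ 2 := by positivity
  linarith

theorem exists_norm_le_of_actSum_le (hF : ∀ j, Continuous (F j))
    (hFper : ∀ j x v, IsIntVec v → F j (x + v) = F j x) (m n : ℤ) (a r : ℝ) :
    ∃ R : ℝ, 0 ≤ R ∧ ∀ γ : ℤ → EuclideanSpace ℝ (Fin d), ‖γ m‖ ≤ r → actSum F m n γ ≤ a →
      ∀ i, m ≤ i → i ≤ n → ‖γ i‖ ≤ R := by
  obtain ⟨C, hC⟩ := exists_half_sq_norm_le_actSum_add hF hFper m n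
  set L := √(2 * (a + C))
  refine ⟨|r| + (n - m).toNat * L, by positivity, fun γ hr ha i hmi hin => ?_⟩
  have key : ∀ k : ℕ, m + k ≤ n → ‖γ (m + k)‖ ≤ |r| + k * L := by
    intro k hk
    induction k with
    | zero => simpa using hr.trans (le_abs_self r)
    | succ k ih =>
      push_cast at hk ⊢
      have h1 := ih (by omega)
      have h2 := hC γ (m + k) (Finset.mem_Ico.2 ⟨by omega, by omega⟩)
      have h3 : ‖γ (m + k + 1) - γ (m + k)‖ ≤ L := Real.le_sqrt_of_sq_le (by linarith)
      have h4 := norm_le_norm_add_norm_sub' (γ (m + k + 1)) (γ (m + k))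
      rw [← add_assoc]
      linarith
  obtain ⟨k, rfl⟩ := Int.le.dest hmi
  refine (key k hin).trans ?_
  have : k ≤ (n - m).toNat := by omega
  gcongr

open Topology in
/-- Near the endpoints of a unique minimizer, minimizers exist and stay close to it. -/
theorem eventually_exists_minimizer_mem (hF : ∀ j, Continuous (F j))
    (hFper : ∀ j x v, IsIntVec v → F j (x + v) = F j x) {m n : ℤ} (hmn : m < n)
    {x : ℤ → EuclideanSpace ℝ (Fin d)}
    (hattain : actSum F m n x = actInf F m n (x m) (x n))
    (hunique : ∀ γ : ℤ → EuclideanSpace ℝ (Fin d), γ m = x m → γ n = x n →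
      actSum F m n γ = actInf F m n (x m) (x n) → ∀ j, m ≤ j → j ≤ n → γ j = x j)
    {O : Set (ℤ → EuclideanSpace ℝ (Fin d))} (hO : IsOpen O)
    (hxO : ∀ γ : ℤ → EuclideanSpace ℝ (Fin d), (∀ j, m ≤ j → j ≤ n → γ j = x j) → γ ∈ O) :
    ∀ᶠ p : EuclideanSpace ℝ (Fin d) × EuclideanSpace ℝ (Fin d) in 𝓝 (x m, x n),
      ∃ γ ∈ O, γ m = p.1 ∧ γ n = p.2 ∧
        ∀ γ' : ℤ → EuclideanSpace ℝ (Fin d), γ' m = p.1 → γ' n = p.2 →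
          actSum F m n γ ≤ actSum F m n γ' := by
  have hact := continuous_actSum hF m n
  let upd : EuclideanSpace ℝ (Fin d) × EuclideanSpace ℝ (Fin d) → ℤ → EuclideanSpace ℝ (Fin d) :=
    fun p => Function.update (Function.update x m p.1) n p.2
  have hupd : Continuous upd := by
    refine Continuous.update (A := fun _ => EuclideanSpace ℝ (Fin d)) ?_ n continuous_snd
    exact Continuous.update (A := fun _ => EuclideanSpace ℝ (Fin d)) continuous_const m
      continuous_fst
  have hupd_m : ∀ p, upd p m = p.1 := fun p => by simp [upd, hmn.ne]
  have hupd_n : ∀ p, upd p n = p.2 := fun p => by simp [upd]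
  have hupd_x : upd (x m, x n) = x := by simp [upd]
  obtain ⟨R, hR0, hR⟩ := exists_norm_le_of_actSum_le hF hFper m n
    (actSum F m n x + 1) (‖x m‖ + 1)
  let K : Set (ℤ → EuclideanSpace ℝ (Fin d)) := Set.univ.pi fun _ => Metric.closedBall 0 R
  have hK : IsCompact K := isCompact_univ_pi fun _ => isCompact_closedBall _ _
  let trunc : (ℤ → EuclideanSpace ℝ (Fin d)) → ℤ → EuclideanSpace ℝ (Fin d) :=
    fun γ i => if m ≤ i ∧ i ≤ n then γ i else 0
  have htrunc : ∀ γ i, m ≤ i → i ≤ n → trunc γ i = γ i := fun γ i h1 h2 => if_pos ⟨h1, h2⟩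
  have htrunc_act : ∀ γ, actSum F m n (trunc γ) = actSum F m n γ := fun γ =>
    actSum_congr (htrunc γ)
  have hclosed : IsClosed {z : (EuclideanSpace ℝ (Fin d) × EuclideanSpace ℝ (Fin d)) ×
      (ℤ → EuclideanSpace ℝ (Fin d)) |
      z.2 m = z.1.1 ∧ z.2 n = z.1.2 ∧ actSum F m n z.2 ≤ actSum F m n (upd z.1)} := by
    refine (isClosed_eq (by fun_prop) (by fun_prop)).inter
      ((isClosed_eq (by fun_prop) (by fun_prop)).inter
        (isClosed_le (hact.comp continuous_snd) (hact.comp (hupd.comp continuous_fst))))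
  have hfar : ∀ᶠ p in 𝓝 (x m, x n), ∀ γ ∈ K \ O,
      ¬ (γ m = p.1 ∧ γ n = p.2 ∧ actSum F m n γ ≤ actSum F m n (upd p)) := by
    refine (hK.diff hO).eventually_forall_of_forall_eventually fun γ hγ => ?_
    refine hclosed.isOpen_compl.mem_nhds ?_
    rintro ⟨h1, h2, h3⟩
    dsimp only at h1 h2 h3
    rw [hupd_x] at h3
    refine hγ.2 (hxO γ (hunique γ h1 h2 (le_antisymm (h3.trans hattain.le) ?_)))
    exact csInf_le (bddBelow_actSum hF hFper hmn _ _) ⟨γ, h1, h2, rfl⟩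
  have hval : ∀ᶠ p in 𝓝 (x m, x n), actSum F m n (upd p) < actSum F m n x + 1 := by
    refine (hact.comp hupd).continuousAt.eventually_lt_const ?_
    simp [hupd_x]
  have hnorm : ∀ᶠ p : EuclideanSpace ℝ (Fin d) × EuclideanSpace ℝ (Fin d) in 𝓝 (x m, x n),
      ‖p.1‖ < ‖x m‖ + 1 :=
    (continuous_fst.norm).continuousAt.eventually_lt_const (by simp)
  filter_upwards [hfar, hval, hnorm] with p hp1 hp2 hp3
  have hsub : ∀ γ : ℤ → EuclideanSpace ℝ (Fin d), γ m = p.1 →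
      actSum F m n γ ≤ actSum F m n (upd p) → trunc γ ∈ K := by
    intro γ h1 h2 i _
    rw [mem_closedBall_zero_iff]
    by_cases hi : m ≤ i ∧ i ≤ n
    · rw [htrunc γ i hi.1 hi.2]
      exact hR γ (h1 ▸ hp3.le) (h2.trans hp2.le) i hi.1 hi.2
    · simpa [trunc, hi] using hR0
  have hends : IsClosed {γ : ℤ → EuclideanSpace ℝ (Fin d) | γ m = p.1 ∧ γ n = p.2} :=
    (isClosed_eq (by fun_prop) (by fun_prop)).inter (isClosed_eq (by fun_prop) (by fun_prop))
  have htrunc_mem : ∀ γ : ℤ → EuclideanSpace ℝ (Fin d), γ m = p.1 → γ n = p.2 →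
      actSum F m n γ ≤ actSum F m n (upd p) → trunc γ ∈ K ∩ {γ | γ m = p.1 ∧ γ n = p.2} := by
    intro γ h1 h2 h3
    refine ⟨hsub γ h1 h3, ?_, ?_⟩
    · rw [htrunc γ m le_rfl hmn.le, h1]
    · rw [htrunc γ n hmn.le le_rfl, h2]
  have hupd_mem := htrunc_mem (upd p) (hupd_m p) (hupd_n p) le_rfl
  obtain ⟨γ, ⟨hγK, hγm, hγn⟩, hγmin⟩ :=
    (hK.inter_right hends).exists_isMinOn ⟨_, hupd_mem⟩ hact.continuousOn
  have hγle : actSum F m n γ ≤ actSum F m n (upd p) := htrunc_act (upd p) ▸ hγmin hupd_mem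
  refine ⟨γ, ?_, hγm, hγn, fun γ' h1 h2 => ?_⟩
  · by_contra hγO
    exact hp1 γ ⟨hγK, hγO⟩ ⟨hγm, hγn, hγle⟩
  · rcases le_total (actSum F m n γ') (actSum F m n (upd p)) with h | h
    · exact htrunc_act γ' ▸ hγmin (htrunc_mem γ' h1 h2 h)
    · exact hγle.trans h

end Kick

/-- **Smoothness of the action at a disconjugate minimizer.** If the orbit
`(x_j,v_j)_{j=m}^n` of the kicked maps generates the unique minimizing configuration of
`Ã_{m,n}(x_m,x_n)`, the partial derivatives of `Ã_{m,n}` exist at `(x_m,x_n)`, and the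
orbit is disconjugate, then `Ã_{m,n}` is `C²` near `(x_m,x_n)`; moreover, writing
`DΦ_{m,n}(x_m,v_m) = [[𝒜,ℬ],[𝒞,𝒟]]` in block form, `ℬ` is invertible and the Hessian
`∂²₂₂Ã_{m,n}(x_m,x_n)` is the symmetric matrix `𝒟ℬ⁻¹`, whose graph is the image
`DΦ_{m,n}(x_m,v_m)({0} × ℝ^d)` of the vertical subspace. -/
theorem action_smooth_at_disconjugate_minimizer
    (d : ℕ) (hd : 1 ≤ d)
    (F : ℤ → EuclideanSpace ℝ (Fin d) → ℝ)
    (hF : ∀ j, ContDiff ℝ 2 (F j))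
    (hFper : ∀ j x v, IsIntVec v → F j (x + v) = F j x)
    (m n : ℤ) (hmn : m < n)
    (x v : ℤ → EuclideanSpace ℝ (Fin d))
    (horb : ∀ j, m ≤ j → j < n → kick F j (x j, v j) = (x (j + 1), v (j + 1)))
    (hattain : actSum F m n x = actInf F m n (x m) (x n))
    (hunique : ∀ γ : ℤ → EuclideanSpace ℝ (Fin d), γ m = x m → γ n = x n →
      actSum F m n γ = actInf F m n (x m) (x n) → ∀ j, m ≤ j → j ≤ n → γ j = x j)
    (hd1 : DifferentiableAt ℝ (fun y => actInf F m n y (x n)) (x m))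
    (hd2 : DifferentiableAt ℝ (fun y => actInf F m n (x m) y) (x n))
    (hdisc : ∀ k l : ℤ, m ≤ k → k < l → l ≤ n →
      ∀ s : EuclideanSpace ℝ (Fin d),
        (fderiv ℝ (kickComp F k (l - k).toNat) (x k, v k) (0, s)).1 = 0 →
        fderiv ℝ (kickComp F k (l - k).toNat) (x k, v k) (0, s) = 0) :
    (∃ U : Set (EuclideanSpace ℝ (Fin d) × EuclideanSpace ℝ (Fin d)),
      IsOpen U ∧ (x m, x n) ∈ U ∧
      ContDiffOn ℝ 2 (fun p => actInf F m n p.1 p.2) U) ∧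
    Function.Bijective (fun s : EuclideanSpace ℝ (Fin d) =>
      (fderiv ℝ (kickComp F m (n - m).toNat) (x m, v m) (0, s)).1) ∧
    (∀ u w : EuclideanSpace ℝ (Fin d),
      ⟪fderiv ℝ (fun y => gradient (fun y' => actInf F m n (x m) y') y) (x n) u, w⟫ =
      ⟪u, fderiv ℝ (fun y => gradient (fun y' => actInf F m n (x m) y') y) (x n) w⟫) ∧
    ∀ s : EuclideanSpace ℝ (Fin d),
      fderiv ℝ (fun y => gradient (fun y' => actInf F m n (x m) y') y) (x n)
          ((fderiv ℝ (kickComp F m (n - m).toNat) (x m, v m) (0, s)).1) =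
        (fderiv ℝ (kickComp F m (n - m).toNat) (x m, v m) (0, s)).2 := by
  obtain ⟨N, rfl⟩ := Int.le.dest hmn.le
  have hN : (m + (N : ℤ) - m).toNat = N := by simp
  have hdiscN := hdisc m (m + N) le_rfl hmn le_rfl
  rw [hN] at hdiscN ⊢
  have hFc : ∀ j, Continuous (F j) := fun j => (hF j).continuous
  have hΦ := contDiff_kickComp hF m N
  have hΦd : ∀ p, HasFDerivAt (kickComp F m N) (fderiv ℝ (kickComp F m N) p) p := fun p =>
    (hΦ.differentiable one_ne_zero p).hasFDerivAt
  have hΦx : kickComp F m N (x m, v m) = (x (m + N), v (m + N)) := kickComp_eq_of_orbit horb le_rfl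
  -- the vertical block is invertible
  have hvert : ∀ s, (fderiv ℝ (kickComp F m N) (x m, v m) (0, s)).1 = 0 → s = 0 := by
    intro s hs
    have h0 : ((0, s) : EuclideanSpace ℝ (Fin d) × EuclideanSpace ℝ (Fin d)) = 0 :=
      (injective_iff_map_eq_zero _).1 (injective_fderiv_kickComp hF m N (x m, v m)) _
        (hdiscN s hs)
    exact (Prod.mk_eq_zero.1 h0).2
  have hinj : Function.Injective fun s : EuclideanSpace ℝ (Fin d) =>
      (fderiv ℝ (kickComp F m N) (x m, v m) (0, s)).1 :=
    (injective_iff_map_eq_zero ((ContinuousLinearMap.fst ℝ _ _).comp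
      ((fderiv ℝ (kickComp F m N) (x m, v m)).comp (ContinuousLinearMap.inr ℝ _ _)))).2 hvert
  have hbij : Function.Bijective fun s : EuclideanSpace ℝ (Fin d) =>
      (fderiv ℝ (kickComp F m N) (x m, v m) (0, s)).1 :=
    ⟨hinj, LinearMap.injective_iff_surjective (f := ((ContinuousLinearMap.fst ℝ _ _).comp
      ((fderiv ℝ (kickComp F m N) (x m, v m)).comp
        (ContinuousLinearMap.inr ℝ _ _))).toLinearMap).1 hinj⟩
  -- the endpoint map is a local diffeomorphism
  let H : EuclideanSpace ℝ (Fin d) × EuclideanSpace ℝ (Fin d) →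
      EuclideanSpace ℝ (Fin d) × EuclideanSpace ℝ (Fin d) := fun p => (p.1, (kickComp F m N p).1)
  let H' : EuclideanSpace ℝ (Fin d) × EuclideanSpace ℝ (Fin d) →
      EuclideanSpace ℝ (Fin d) × EuclideanSpace ℝ (Fin d) →L[ℝ]
      EuclideanSpace ℝ (Fin d) × EuclideanSpace ℝ (Fin d) := fun p =>
    (ContinuousLinearMap.fst ℝ _ _).prod
      ((ContinuousLinearMap.fst ℝ _ _).comp (fderiv ℝ (kickComp F m N) p))
  have hH : ContDiff ℝ 1 H := contDiff_fst.prodMk hΦ.fst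
  have hHd : ∀ p, HasFDerivAt H (H' p) p := fun p => hasFDerivAt_fst.prodMk (hΦd p).fst
  have hHx : H (x m, v m) = (x m, x (m + N)) := by simp only [H, hΦx]
  have hH'inj : Function.Injective (H' (x m, v m)) := by
    refine (injective_iff_map_eq_zero _).2 ?_
    rintro ⟨a, b⟩ h
    obtain ⟨h1, h2⟩ := Prod.mk_eq_zero.1 h
    change a = 0 at h1
    subst h1
    rw [hvert b h2, Prod.mk_zero_zero]
  let D : (EuclideanSpace ℝ (Fin d) × EuclideanSpace ℝ (Fin d)) ≃L[ℝ]
      EuclideanSpace ℝ (Fin d) × EuclideanSpace ℝ (Fin d) :=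
    (LinearEquiv.ofInjectiveEndo (H' (x m, v m)).toLinearMap hH'inj).toContinuousLinearEquiv
  have hD : (D : EuclideanSpace ℝ (Fin d) × EuclideanSpace ℝ (Fin d) →L[ℝ]
      EuclideanSpace ℝ (Fin d) × EuclideanSpace ℝ (Fin d)) = H' (x m, v m) :=
    ContinuousLinearMap.ext fun _ => rfl
  have hHD : HasFDerivAt H (D : EuclideanSpace ℝ (Fin d) × EuclideanSpace ℝ (Fin d) →L[ℝ]
      EuclideanSpace ℝ (Fin d) × EuclideanSpace ℝ (Fin d)) (x m, v m) := hD ▸ hHd _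
  let e := hH.contDiffAt.toOpenPartialHomeomorph H hHD one_ne_zero
  have he : ∀ p, e p = H p := fun _ => rfl
  have hxs : (x m, v m) ∈ e.source :=
    hH.contDiffAt.mem_toOpenPartialHomeomorph_source hHD one_ne_zero
  have hxt : (x m, x (m + N)) ∈ e.target := by
    rw [← hHx, ← he]
    exact e.map_source hxs
  have hesx : e.symm (x m, x (m + N)) = (x m, v m) := by
    rw [← hHx, ← he]
    exact e.left_inv hxs
  have hed : HasFDerivAt e.symm (D.symm : EuclideanSpace ℝ (Fin d) × EuclideanSpace ℝ (Fin d) →L[ℝ]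
      EuclideanSpace ℝ (Fin d) × EuclideanSpace ℝ (Fin d)) (x m, x (m + N)) :=
    e.hasFDerivAt_symm hxt (by rw [hesx]; exact hHD)
  have hec : ContDiffAt ℝ 1 e.symm (x m, x (m + N)) :=
    e.contDiffAt_symm hxt (by rw [hesx]; exact hHD) hH.contDiffAt
  -- near the endpoints, the action is that of the orbit selected by the local inverse
  have hloc : ∀ᶠ p : EuclideanSpace ℝ (Fin d) × EuclideanSpace ℝ (Fin d) in nhds (x m, x (m + N)),
      actInf F m (m + N) p.1 p.2 = actSum F m (m + N) (orbitConfig F m (e.symm p)) := by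
    let O : Set (ℤ → EuclideanSpace ℝ (Fin d)) :=
      {γ | (γ m, γ (m + 1) - γ m + gradient (F m) (γ m)) ∈ e.source}
    have hO : IsOpen O := by
      have hg := (contDiff_gradient_of_contDiff_two (hF m)).continuous
      exact e.open_source.preimage (by fun_prop)
    have hxO : ∀ γ : ℤ → EuclideanSpace ℝ (Fin d),
        (∀ j, m ≤ j → j ≤ m + N → γ j = x j) → γ ∈ O := by
      intro γ hγ
      have h := horb m le_rfl hmn
      simp only [kick, Prod.mk.injEq] at h
      change (γ m, γ (m + 1) - γ m + gradient (F m) (γ m)) ∈ e.source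
      rw [hγ m le_rfl hmn.le, hγ (m + 1) (by omega) (by omega), ← h.1]
      convert hxs using 2
      abel
    filter_upwards [eventually_exists_minimizer_mem hFc hFper hmn hattain hunique hO hxO]
      with p ⟨γ, hγO, hγm, hγn, hγmin⟩
    have hmin : ∀ γ' : ℤ → EuclideanSpace ℝ (Fin d), γ' m = γ m → γ' (m + N) = γ (m + N) →
        actSum F m (m + N) γ ≤ actSum F m (m + N) γ' := fun γ' h1 h2 =>
      hγmin γ' (h1.trans hγm) (h2.trans hγn)
    have horbit := fun k hk => kickComp_fst_of_minimizer hF hmin (k := k) hk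
    have hp : e.symm p = (γ m, γ (m + 1) - γ m + gradient (F m) (γ m)) := by
      rw [← e.left_inv hγO, he]
      congr 1
      exact Prod.ext hγm.symm ((horbit N le_rfl).trans hγn).symm
    have hact : actSum F m (m + N) (orbitConfig F m (e.symm p)) = actSum F m (m + N) γ := by
      refine actSum_congr fun i h1 h2 => ?_
      obtain ⟨k, rfl⟩ := Int.le.dest h1
      rw [orbitConfig_add, hp, horbit k (by omega)]
    rw [hact]
    refine IsLeast.csInf_eq ⟨⟨γ, hγm, hγn, rfl⟩, ?_⟩
    rintro a ⟨γ', h1, h2, rfl⟩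
    exact hγmin γ' h1 h2
  let A' : EuclideanSpace ℝ (Fin d) × EuclideanSpace ℝ (Fin d) →
      EuclideanSpace ℝ (Fin d) × EuclideanSpace ℝ (Fin d) →L[ℝ] ℝ := fun p =>
    (innerSL ℝ (kickComp F m N (e.symm p)).2).comp (ContinuousLinearMap.snd ℝ _ _) -
      (innerSL ℝ (e.symm p).2).comp (ContinuousLinearMap.fst ℝ _ _)
  have hA' : ∀ᶠ p in nhds (x m, x (m + N)),
      HasFDerivAt (fun p : EuclideanSpace ℝ (Fin d) × EuclideanSpace ℝ (Fin d) =>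
        actInf F m (m + N) p.1 p.2) (A' p) p := by
    filter_upwards [hloc.eventually_nhds, hec.eventually (by simp),
      e.open_target.mem_nhds hxt] with p hp1 hp2 hp3
    have hes : HasFDerivAt e.symm (fderiv ℝ e.symm p) p :=
      (hp2.differentiableAt one_ne_zero).hasFDerivAt
    have hinv : (H' (e.symm p)).comp (fderiv ℝ e.symm p) = ContinuousLinearMap.id ℝ _ := by
      refine ((hHd (e.symm p)).comp p hes).unique ((hasFDerivAt_id p).congr_of_eventuallyEq ?_)
      filter_upwards [e.open_target.mem_nhds hp3] with q hq using e.right_inv hq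
    refine (((hasFDerivAt_actSum_orbitConfig hF m N (e.symm p)).comp p hes).congr_of_eventuallyEq
      hp1).congr_fderiv ?_
    refine ContinuousLinearMap.ext fun δ => ?_
    have hδ := DFunLike.congr_fun hinv δ
    have hδ1 : (fderiv ℝ e.symm p δ).1 = δ.1 := (Prod.ext_iff.1 hδ).1
    have hδ2 : (fderiv ℝ (kickComp F m N) (e.symm p) (fderiv ℝ e.symm p δ)).1 = δ.2 :=
      (Prod.ext_iff.1 hδ).2
    simp [A', hδ1, hδ2]
  have hA'c : ContDiffAt ℝ 1 A' (x m, x (m + N)) := by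
    have h1 : ContDiffAt ℝ 1 (fun p => innerSL ℝ (kickComp F m N (e.symm p)).2)
        (x m, x (m + N)) :=
      (innerSL ℝ).contDiff.contDiffAt.comp _ ((hΦ.contDiffAt.comp _ hec).snd)
    have h2 : ContDiffAt ℝ 1 (fun p => innerSL ℝ (e.symm p).2) (x m, x (m + N)) :=
      (innerSL ℝ).contDiff.contDiffAt.comp _ hec.snd
    exact (h1.clm_comp contDiffAt_const).sub (h2.clm_comp contDiffAt_const)
  -- the gradient in the second endpoint is the final velocity
  let g : EuclideanSpace ℝ (Fin d) → EuclideanSpace ℝ (Fin d) := fun y =>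
    (kickComp F m N (e.symm (x m, y))).2
  have hslice : HasFDerivAt (fun y : EuclideanSpace ℝ (Fin d) => (x m, y))
      (ContinuousLinearMap.inr ℝ (EuclideanSpace ℝ (Fin d)) (EuclideanSpace ℝ (Fin d)))
      (x (m + N)) := hasFDerivAt_prodMk_right _ _
  have hgrad : ∀ᶠ y in nhds (x (m + N)),
      HasGradientAt (fun y' => actInf F m (m + N) (x m) y') (g y) y := by
    filter_upwards [(Continuous.prodMk_right (x m)).continuousAt.eventually hA'] with y hy
    refine hasGradientAt_iff_hasFDerivAt.2
      ((hy.comp y (hasFDerivAt_prodMk_right _ _)).congr_fderiv ?_)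
    refine ContinuousLinearMap.ext fun δ => ?_
    simp [A', g]
  have hg' : HasFDerivAt g ((ContinuousLinearMap.snd ℝ _ _).comp
      ((fderiv ℝ (kickComp F m N) (x m, v m)).comp
        ((D.symm : EuclideanSpace ℝ (Fin d) × EuclideanSpace ℝ (Fin d) →L[ℝ]
          EuclideanSpace ℝ (Fin d) × EuclideanSpace ℝ (Fin d)).comp
          (ContinuousLinearMap.inr ℝ _ _)))) (x (m + N)) := by
    have h1 := hΦd (e.symm (x m, x (m + N)))
    rw [hesx] at h1
    have h2 := hed.comp (x (m + N)) hslice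
    exact (HasFDerivAt.comp (x (m + N)) (by simpa only [Function.comp_apply, hesx] using h1) h2).snd
  have hgeq : (fun y => gradient (fun y' => actInf F m (m + N) (x m) y') y)
      =ᶠ[nhds (x (m + N))] g := hgrad.mono fun y hy => hy.gradient
  rw [hgeq.fderiv_eq]
  refine ⟨?_, hbij, fun u w => ?_, fun s => ?_⟩
  · have h : ContDiffAt ℝ 2 (fun p : EuclideanSpace ℝ (Fin d) × EuclideanSpace ℝ (Fin d) =>
        actInf F m (m + N) p.1 p.2) (x m, x (m + N)) :=
      contDiffAt_succ_iff_hasFDerivAt (n := 1).2 ⟨A', ⟨_, hA', fun _ hp => hp⟩, hA'c⟩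
    obtain ⟨U, hU, hxU, hc⟩ := h.contDiffOn' le_rfl (by simp)
    refine ⟨U, hU, hxU, ?_⟩
    simpa using hc
  · have hsymm := second_derivative_symmetric_of_eventually
      (hgrad.mono fun y hy => hasGradientAt_iff_hasFDerivAt.1 hy)
      (((innerSL ℝ : EuclideanSpace ℝ (Fin d) →L[ℝ] _).hasFDerivAt (x := g (x (m + N)))).comp
        (x (m + N)) hg'.differentiableAt.hasFDerivAt) u w
    change ⟪fderiv ℝ g (x (m + N)) u, w⟫ = ⟪fderiv ℝ g (x (m + N)) w, u⟫ at hsymm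
    rw [hsymm, real_inner_comm]
  · have hDs : D.symm (0, (fderiv ℝ (kickComp F m N) (x m, v m) (0, s)).1) = (0, s) := by
      rw [D.symm_apply_eq]
      rfl
    rw [hg'.fderiv]
    simp only [ContinuousLinearMap.comp_apply, ContinuousLinearMap.inr_apply,
      ContinuousLinearEquiv.coe_coe, hDs, ContinuousLinearMap.coe_snd']
end
end
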